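/- arXiv:2407.12047 — 2 statements merged into one kernel-verified Lean document; each statement's English description precedes it below -/
import Mathlib

section
/- The constant Cb = 1 + e^γ·∑_{p prime} (ln p)/p² satisfies 1.8782309744528944880 < Cb < 1.8782309744528944881, where γ is the Euler–Mascheroni constant and the prime sum converges. -/
open Real

section
open Filter Topology MeasureTheory
open scoped Nat

namespace EulerMaclaurin

/-- Coefficients of the iterated derivatives of `(a * log x + b) / x ^ r`;
see `hasDerivAt_logPow`. -/
def coeffs (r : ℕ) (a b : ℚ) : ℕ → ℚ × ℚ
  | 0 => (a, b)
  | j + 1 => (-(r + j) * (coeffs r a b j).1, (coeffs r a b j).1 - (r + j) * (coeffs r a b j).2)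

/-- The `j`-th derivative of `(a * log x + b) / x ^ r`. -/
noncomputable def logPow (r : ℕ) (a b : ℚ) (j : ℕ) (x : ℝ) : ℝ :=
  ((coeffs r a b j).1 * log x + (coeffs r a b j).2) / x ^ (r + j)

/-- The Euler–Maclaurin antidifference of `logPow r a b 1`, of order `m`. -/
noncomputable def antidiff (r : ℕ) (a b : ℚ) (m : ℕ) (x : ℝ) : ℝ :=
  ∑ j ∈ Finset.range (m + 1), (bernoulli j : ℝ) / j ! * logPow r a b j x

lemma hasDerivAt_logPow (r : ℕ) (a b : ℚ) (j : ℕ) {x : ℝ} (hx : 0 < x) :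
    HasDerivAt (logPow r a b j) (logPow r a b (j + 1) x) x := by
  unfold logPow
  have h := (((hasDerivAt_log hx.ne').const_mul ((coeffs r a b j).1 : ℝ)).add_const
    ((coeffs r a b j).2 : ℝ)).div (hasDerivAt_pow (r + j) x) (by positivity)
  refine h.congr_deriv ?_
  simp only [coeffs]
  push_cast
  rcases Nat.eq_zero_or_pos (r + j) with h0 | h0
  · obtain ⟨rfl, rfl⟩ : r = 0 ∧ j = 0 := by omega
    simp
    field_simp
  · obtain ⟨k, hk⟩ : ∃ k, r + j = k + 1 := ⟨r + j - 1, by omega⟩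
    have hk' : (r : ℝ) + j = k + 1 := by exact_mod_cast hk
    rw [← add_assoc, hk, hk']
    simp only [Nat.add_sub_cancel]
    field_simp
    ring

lemma continuousOn_logPow (r : ℕ) (a b : ℚ) (j : ℕ) {x : ℝ} (hx : 0 < x) :
    ContinuousOn (fun t ↦ logPow r a b j (x + t)) (Set.uIcc 0 1) := by
  intro t ht
  rw [Set.uIcc_of_le zero_le_one] at ht
  have : 0 < x + t := by linarith [ht.1]
  exact (ContinuousAt.comp (f := fun t : ℝ ↦ x + t)
    (hasDerivAt_logPow r a b j this).continuousAt (by fun_prop)).continuousWithinAt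

lemma antidiff_step (r : ℕ) (a b : ℚ) (m : ℕ) {x : ℝ} (hx : 0 < x) :
    antidiff r a b m (x + 1) - antidiff r a b m x - (if m = 0 then 0 else logPow r a b 1 x) =
      ∫ t in (0 : ℝ)..1, bernoulliFun m (1 - t) / m ! * logPow r a b (m + 1) (x + t) := by
  have hderiv (j : ℕ) : ∀ t ∈ Set.uIcc (0 : ℝ) 1,
      HasDerivAt (fun t ↦ logPow r a b j (x + t)) (logPow r a b (j + 1) (x + t)) t := by
    intro t ht
    rw [Set.uIcc_of_le zero_le_one] at ht
    exact (hasDerivAt_logPow r a b j (by linarith [ht.1])).comp_const_add x t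
  induction m with
  | zero =>
    have h := intervalIntegral.integral_eq_sub_of_hasDerivAt (hderiv 0)
      (continuousOn_logPow r a b 1 hx).intervalIntegrable
    simp only [zero_add, add_zero] at h
    simp only [antidiff, bernoulliFun_zero, Nat.factorial_zero, Nat.cast_one, div_one, one_mul,
      zero_add, h]
    simp
  | succ m ih =>
    have hB : ∀ t ∈ Set.uIcc (0 : ℝ) 1, HasDerivAt
        (fun t ↦ bernoulliFun (m + 1) (1 - t) / (m + 1)!) (-(bernoulliFun m (1 - t) / m !)) t := by
      intro t _
      have h := ((hasDerivAt_bernoulliFun (m + 1) (1 - t)).comp t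
        ((hasDerivAt_id t).const_sub 1)).div_const ((m + 1)! : ℝ)
      refine h.congr_deriv ?_
      rw [Nat.factorial_succ]
      push_cast
      field_simp
    rw [intervalIntegral.integral_mul_deriv_eq_deriv_mul hB (hderiv (m + 1))
      (Continuous.intervalIntegrable (by fun_prop) _ _)
      (continuousOn_logPow r a b (m + 2) hx).intervalIntegrable]
    simp only [neg_mul, intervalIntegral.integral_neg, ← ih]
    simp only [antidiff, Finset.sum_range_succ _ (m + 1), sub_self, sub_zero, add_zero,
      bernoulliFun_eval_one, bernoulliFun_eval_zero]
    rcases m with _ | m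
    · simp
      ring
    · simp
      ring

lemma abs_bernoulliFun_le {k : ℕ} (hk : k ≠ 0) {t : ℝ} (ht : t ∈ Set.Icc (0 : ℝ) 1) :
    |bernoulliFun (2 * k) t / (2 * k)!| ≤ 4 / 6 ^ (2 * k) := by
  have h := hasSum_one_div_nat_pow_mul_cos hk ht
  have h2 := hasSum_zeta_two
  have hpi := pi_gt_three
  have hle : |(-1 : ℝ) ^ (k + 1) * (2 * π) ^ (2 * k) / 2 / (2 * k)! * bernoulliFun (2 * k) t|
      ≤ π ^ 2 / 6 := by
    have hterm (n : ℕ) : |1 / (n : ℝ) ^ (2 * k) * Real.cos (2 * π * n * t)| ≤ 1 / (n : ℝ) ^ 2 := by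
      rw [abs_mul, abs_of_nonneg (by positivity)]
      refine (mul_le_of_le_one_right (by positivity) (abs_cos_le_one _)).trans ?_
      rcases Nat.eq_zero_or_pos n with rfl | hn
      · simp [hk]
      · have : (1 : ℝ) ≤ n := by exact_mod_cast hn
        gcongr
        omega
    rw [abs_le]
    constructor
    · exact hasSum_le (fun n ↦ (abs_le.1 (hterm n)).1) h2.neg h
    · exact hasSum_le (fun n ↦ (abs_le.1 (hterm n)).2) h h2
  have hpi2 : π ^ 2 / 6 ≤ 2 := by nlinarith [pi_lt_d2]
  have h6 : (6 : ℝ) ^ (2 * k) ≤ (2 * π) ^ (2 * k) := by gcongr; linarith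
  have heq : |(-1 : ℝ) ^ (k + 1) * (2 * π) ^ (2 * k) / 2 / (2 * k)! * bernoulliFun (2 * k) t| =
      (2 * π) ^ (2 * k) / 2 * |bernoulliFun (2 * k) t / (2 * k)!| := by
    rw [abs_mul, abs_div, abs_div, abs_mul, abs_pow, abs_neg, abs_one, one_pow, one_mul, abs_div,
      abs_of_pos (by positivity : (0 : ℝ) < (2 * π) ^ (2 * k)), abs_two]
    ring
  rw [heq] at hle
  rw [le_div_iff₀ (by positivity)]
  nlinarith [abs_nonneg (bernoulliFun (2 * k) t / (2 * k)!)]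

lemma abs_logPow_le (r : ℕ) (a b : ℚ) (j : ℕ) {x : ℝ} (hx : 1 ≤ x) :
    |logPow r a b (j + 1) x| ≤
      ((|(coeffs r a b (j + 1)).1| + |(coeffs r a b (j + 1)).2| : ℚ) : ℝ) / x ^ (r + j) := by
  have hlog : 0 ≤ log x := log_nonneg hx
  have hlx : log x ≤ x := (log_le_sub_one_of_pos (by linarith)).trans (by linarith)
  rw [logPow, abs_div, abs_of_pos (by positivity : 0 < x ^ (r + (j + 1))),
    div_le_div_iff₀ (by positivity) (by positivity), ← add_assoc, pow_succ, mul_comm (x ^ (r + j)),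
    ← mul_assoc]
  gcongr
  refine (abs_add_le _ _).trans ?_
  rw [abs_mul, abs_of_nonneg hlog]
  push_cast
  nlinarith [abs_nonneg ((coeffs r a b (j + 1)).1 : ℝ), abs_nonneg ((coeffs r a b (j + 1)).2 : ℝ)]

/-- The error constant of the Euler–Maclaurin formula of order `m`. -/
def errConst (r : ℕ) (a b : ℚ) (m : ℕ) : ℚ :=
  4 / 6 ^ m * (|(coeffs r a b (m + 1)).1| + |(coeffs r a b (m + 1)).2|)

lemma errConst_nonneg (r : ℕ) (a b : ℚ) (m : ℕ) : 0 ≤ errConst r a b m := by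
  unfold errConst; positivity

lemma abs_antidiff_step_le (r : ℕ) (a b : ℚ) {k q : ℕ} (hk : k ≠ 0) (hq : r + 2 * k = q + 2)
    {x : ℝ} (hx : 1 ≤ x) :
    |antidiff r a b (2 * k) (x + 1) - antidiff r a b (2 * k) x - logPow r a b 1 x| ≤
      errConst r a b (2 * k) * (1 / x ^ (q + 1) - 1 / (x + 1) ^ (q + 1)) := by
  have h := antidiff_step r a b (2 * k) (x := x) (by linarith)
  rw [if_neg (by omega)] at h
  rw [h]
  have hA (t : ℝ) (ht : t ∈ Set.uIcc (0 : ℝ) 1) :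
      HasDerivAt (fun t ↦ -(1 / (x + t) ^ (q + 1))) ((q + 1) / (x + t) ^ (q + 2)) t := by
    rw [Set.uIcc_of_le zero_le_one] at ht
    have hp : 0 < x + t := by linarith [ht.1]
    have := (((hasDerivAt_id t).const_add x).pow (q + 1)).inv (by simp; positivity)
    simp only [one_div]
    refine this.neg.congr_deriv ?_
    simp
    field_simp
    ring
  have hcont : ContinuousOn (fun t ↦ ((q : ℝ) + 1) / (x + t) ^ (q + 2)) (Set.uIcc 0 1) := by
    intro t ht
    rw [Set.uIcc_of_le zero_le_one] at ht
    have hp : 0 < x + t := by linarith [ht.1]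
    refine ContinuousAt.continuousWithinAt ?_
    fun_prop (disch := positivity)
  have hint := intervalIntegral.integral_eq_sub_of_hasDerivAt hA hcont.intervalIntegrable
  have hval : (errConst r a b (2 * k) : ℝ) * (1 / x ^ (q + 1) - 1 / (x + 1) ^ (q + 1)) =
      ∫ t in (0 : ℝ)..1, errConst r a b (2 * k) * (((q : ℝ) + 1) / (x + t) ^ (q + 2)) := by
    rw [intervalIntegral.integral_const_mul, hint, add_zero]
    ring
  rw [hval, ← Real.norm_eq_abs]
  refine intervalIntegral.norm_integral_le_of_norm_le zero_le_one ?_ ?_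
  · refine ae_of_all _ fun t ht ↦ ?_
    have h1 := abs_bernoulliFun_le hk (t := 1 - t) ⟨by linarith [ht.2], by linarith [ht.1]⟩
    have h2 := abs_logPow_le r a b (2 * k) (x := x + t) (by linarith [ht.1])
    have hp : 0 < x + t := by linarith [ht.1]
    rw [Real.norm_eq_abs, abs_mul]
    refine (mul_le_mul h1 h2 (abs_nonneg _) (by positivity)).trans ?_
    rw [hq, errConst]
    push_cast
    rw [← mul_div_assoc, ← mul_div_assoc]
    refine div_le_div_of_nonneg_right ?_ (by positivity)
    refine le_mul_of_one_le_right (by positivity) ?_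
    linarith [(Nat.cast_nonneg q : (0 : ℝ) ≤ q)]
  · exact (hcont.const_mul _ |>.intervalIntegrable)

lemma abs_sum_sub_antidiff_le (r : ℕ) (a b : ℚ) {k q : ℕ} (hk : k ≠ 0) (hq : r + 2 * k = q + 2)
    {N : ℕ} (hN : 1 ≤ N) (d : ℕ) :
    |antidiff r a b (2 * k) (N + d : ℕ) - antidiff r a b (2 * k) N -
        ∑ i ∈ Finset.range d, logPow r a b 1 (N + i : ℕ)| ≤
      errConst r a b (2 * k) * (1 / (N : ℝ) ^ (q + 1) - 1 / ((N + d : ℕ) : ℝ) ^ (q + 1)) := by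
  induction d with
  | zero => simp
  | succ d ih =>
    have h := abs_antidiff_step_le r a b hk hq (x := (N + d : ℕ)) (by exact_mod_cast (by omega))
    rw [Finset.sum_range_succ]
    rw [show (((N + (d + 1) : ℕ)) : ℝ) = ((N + d : ℕ) : ℝ) + 1 by push_cast; ring]
    rw [abs_le] at *
    constructor <;> linarith [ih.1, ih.2, h.1, h.2]

lemma tendsto_logPow {r : ℕ} {j : ℕ} (h : r + j ≠ 0) (a b : ℚ) :
    Tendsto (fun d : ℕ ↦ logPow r a b j d) atTop (𝓝 0) := by
  suffices h1 : Tendsto (logPow r a b j) atTop (𝓝 0) from h1.comp tendsto_natCast_atTop_atTop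
  have h2 := (isLittleO_log_id_atTop).tendsto_div_nhds_zero
  have h4 := (h2.const_mul ((coeffs r a b j).1 : ℝ)).add
    (tendsto_inv_atTop_zero.const_mul ((coeffs r a b j).2 : ℝ))
  simp only [mul_zero, add_zero] at h4
  refine squeeze_zero_norm' ?_ (tendsto_norm_zero.comp h4)
  filter_upwards [eventually_ge_atTop 1] with x hx
  simp only [Function.comp, id, norm_eq_abs, logPow]
  rw [show ((coeffs r a b j).1 : ℝ) * (log x / x) + (coeffs r a b j).2 * x⁻¹ =
    ((coeffs r a b j).1 * log x + (coeffs r a b j).2) / x by field_simp, abs_div, abs_div]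
  rw [abs_of_pos (by positivity : 0 < x), abs_of_pos (by positivity : 0 < x ^ (r + j))]
  gcongr
  exact le_self_pow₀ hx h

lemma tendsto_antidiff_sub (r : ℕ) (a b : ℚ) (m : ℕ) :
    Tendsto (fun d : ℕ ↦ antidiff r a b m d - logPow r a b 0 d) atTop (𝓝 0) := by
  have h : (fun d : ℕ ↦ antidiff r a b m d - logPow r a b 0 d) = fun d : ℕ ↦
      ∑ j ∈ Finset.range m, (bernoulli (j + 1) : ℝ) / (j + 1)! * logPow r a b (j + 1) d := by
    ext d
    rw [antidiff, Finset.sum_range_succ']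
    simp
  rw [h, show (0 : ℝ) = ∑ j ∈ Finset.range m, (bernoulli (j + 1) : ℝ) / (j + 1)! * 0 by simp]
  exact tendsto_finsetSum _ fun j _ ↦ (tendsto_logPow (by omega) a b).const_mul _

/-- Euler–Maclaurin summation for the derivative of `(a * log x + b) / x ^ r`. -/
theorem abs_lim_sub_le (r : ℕ) (a b : ℚ) {k q : ℕ} (hk : k ≠ 0) (hq : r + 2 * k = q + 2)
    {N : ℕ} (hN : 1 ≤ N) {L : ℝ}
    (hL : Tendsto (fun M : ℕ ↦ (∑ n ∈ Finset.range M, logPow r a b 1 n) - logPow r a b 0 M)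
      atTop (𝓝 L)) :
    |L - ((∑ n ∈ Finset.range N, logPow r a b 1 n) - antidiff r a b (2 * k) N)| ≤
      errConst r a b (2 * k) / (N : ℝ) ^ (q + 1) := by
  have h1 := (tendsto_antidiff_sub r a b (2 * k)).sub hL
  have h2 := ((h1.comp (tendsto_add_atTop_nat N)).add_const
    ((∑ n ∈ Finset.range N, logPow r a b 1 n) - antidiff r a b (2 * k) N)).abs
  rw [show |L - ((∑ n ∈ Finset.range N, logPow r a b 1 n) - antidiff r a b (2 * k) N)| =
    |0 - L + ((∑ n ∈ Finset.range N, logPow r a b 1 n) - antidiff r a b (2 * k) N)| by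
      rw [← abs_neg]; congr 1; ring]
  refine le_of_tendsto h2 (Eventually.of_forall fun d ↦ ?_)
  have h3 := abs_sum_sub_antidiff_le r a b hk hq hN d
  have hsum : ∑ n ∈ Finset.range (d + N), logPow r a b 1 n =
      (∑ n ∈ Finset.range N, logPow r a b 1 n) +
        ∑ i ∈ Finset.range d, logPow r a b 1 (N + i : ℕ) := by
    rw [add_comm d N, Finset.sum_range_add]
  simp only [Function.comp, hsum]
  rw [add_comm d N]
  refine le_trans (le_of_eq ?_) (h3.trans ?_)
  · congr 1; ring
  · rw [div_eq_mul_one_div (errConst r a b (2 * k) : ℝ)]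
    have : (0 : ℝ) ≤ errConst r a b (2 * k) := by exact_mod_cast errConst_nonneg r a b _
    refine mul_le_mul_of_nonneg_left ?_ this
    exact sub_le_self _ (by positivity : (0 : ℝ) ≤ 1 / ((N + d : ℕ) : ℝ) ^ (q + 1))

end EulerMaclaurin

namespace PrimeSum
open ArithmeticFunction (vonMangoldt)

lemma lseries_natCast (f : ℕ → ℝ) {s : ℕ} (hs : s ≠ 0) :
    LSeries (fun n ↦ (f n : ℂ)) s = ((∑' n : ℕ, f n / (n : ℝ) ^ s : ℝ) : ℂ) := by
  rw [Complex.ofReal_tsum]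
  refine tsum_congr fun n ↦ ?_
  rcases eq_or_ne n 0 with rfl | hn
  · simp [hs]
  · simp [LSeries.term_of_ne_zero hn]

lemma summable_of_lseriesSummable (f : ℕ → ℝ) {s : ℕ} (hs : s ≠ 0)
    (h : LSeriesSummable (fun n ↦ (f n : ℂ)) s) : Summable fun n : ℕ ↦ f n / (n : ℝ) ^ s := by
  rw [← Complex.summable_ofReal]
  refine h.congr fun n ↦ ?_
  rcases eq_or_ne n 0 with rfl | hn
  · simp [hs]
  · simp [LSeries.term_of_ne_zero hn]

lemma one_lt_natCast_re {s : ℕ} (hs : 2 ≤ s) : 1 < (s : ℂ).re := by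
  simpa using (by omega : 1 < s)

lemma summable_vonMangoldt {s : ℕ} (hs : 2 ≤ s) :
    Summable fun n : ℕ ↦ vonMangoldt n / (n : ℝ) ^ s :=
  summable_of_lseriesSummable _ (by omega)
    (ArithmeticFunction.LSeriesSummable_vonMangoldt (one_lt_natCast_re hs))

lemma log_eq_complex : (fun n : ℕ ↦ ((log n : ℝ) : ℂ)) = fun n : ℕ ↦ Complex.log n := by
  ext n
  rw [Complex.natCast_log]

lemma lseriesSummable_one {s : ℕ} (hs : 2 ≤ s) : LSeriesSummable 1 (s : ℂ) :=
  LSeriesSummable_one_iff.2 (one_lt_natCast_re hs)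

lemma summable_log {s : ℕ} (hs : 2 ≤ s) : Summable fun n : ℕ ↦ log n / (n : ℝ) ^ s := by
  refine summable_of_lseriesSummable (fun n ↦ log n) (by omega) ?_
  rw [log_eq_complex, ← ArithmeticFunction.convolution_vonMangoldt_const_one]
  exact (ArithmeticFunction.LSeriesSummable_vonMangoldt (one_lt_natCast_re hs)).convolution
    (lseriesSummable_one hs)

lemma tsum_vonMangoldt_mul {s : ℕ} (hs : 2 ≤ s) :
    (∑' n : ℕ, vonMangoldt n / (n : ℝ) ^ s) * ∑' n : ℕ, 1 / (n : ℝ) ^ s =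
      ∑' n : ℕ, log n / (n : ℝ) ^ s := by
  have h := LSeries_convolution'
    (ArithmeticFunction.LSeriesSummable_vonMangoldt (one_lt_natCast_re hs))
    (lseriesSummable_one hs)
  rw [ArithmeticFunction.convolution_vonMangoldt_const_one, ← log_eq_complex,
    show (1 : ℕ → ℂ) = fun _ ↦ ((1 : ℝ) : ℂ) by ext; simp] at h
  rw [lseries_natCast (fun n ↦ log n) (by omega), lseries_natCast (fun n ↦ vonMangoldt n) (by omega),
    lseries_natCast (fun _ ↦ 1) (by omega)] at h
  exact_mod_cast h.symm

lemma hasSum_geometric_primes {s : ℕ} (hs : 2 ≤ s) (p : Nat.Primes) :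
    HasSum (fun k : ℕ ↦ vonMangoldt ((p : ℕ) ^ (k + 1)) / (((p : ℕ) ^ (k + 1) : ℕ) : ℝ) ^ s)
      (log (p : ℕ) / (((p : ℕ) : ℝ) ^ s - 1)) := by
  have hp : (1 : ℝ) < (p : ℕ) := by exact_mod_cast p.2.one_lt
  have hps : (1 : ℝ) < ((p : ℕ) : ℝ) ^ s := one_lt_pow₀ hp (by omega)
  have h := (hasSum_geometric_of_lt_one (r := (((p : ℕ) : ℝ) ^ s)⁻¹) (by positivity)
    (inv_lt_one_of_one_lt₀ hps)).mul_left (log (p : ℕ) * (((p : ℕ) : ℝ) ^ s)⁻¹)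
  have hne : ((p : ℕ) : ℝ) ^ s - 1 ≠ 0 := by linarith
  convert! h using 1
  · ext k
    rw [ArithmeticFunction.vonMangoldt_apply_pow (by omega),
      ArithmeticFunction.vonMangoldt_apply_prime p.2]
    push_cast
    rw [← pow_mul, mul_comm (k + 1), pow_mul, pow_succ, inv_pow, div_eq_mul_inv, mul_inv]
    ring
  · have : (1 : ℝ) - (((p : ℕ) : ℝ) ^ s)⁻¹ ≠ 0 := by
      have := inv_lt_one_of_one_lt₀ hps
      linarith
    field_simp

lemma summable_primes {s : ℕ} (hs : 2 ≤ s) :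
    Summable fun p : Nat.Primes ↦ log (p : ℕ) / (((p : ℕ) : ℝ) ^ s - 1) := by
  have h : Summable fun n : {n : ℕ // IsPrimePow n} ↦ vonMangoldt n / ((n : ℕ) : ℝ) ^ s :=
    (summable_vonMangoldt hs).subtype {n | IsPrimePow n}
  rw [← (Nat.Primes.prodNatEquiv).summable_iff] at h
  have h2 := (summable_prod_of_nonneg fun x ↦ by
    simp only [Function.comp, Pi.zero_apply]
    exact div_nonneg ArithmeticFunction.vonMangoldt_nonneg (by positivity)).1 h |>.2
  refine h2.congr fun p ↦ ?_
  exact (hasSum_geometric_primes hs p).tsum_eq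

lemma tsum_primes {s : ℕ} (hs : 2 ≤ s) :
    ∑' p : Nat.Primes, log (p : ℕ) / (((p : ℕ) : ℝ) ^ s - 1) =
      ∑' n : ℕ, vonMangoldt n / (n : ℝ) ^ s := by
  rw [tsum_eq_tsum_primes_of_support_subset_prime_powers (summable_vonMangoldt hs)]
  · exact tsum_congr fun p ↦ (hasSum_geometric_primes hs p).tsum_eq.symm
  · intro n hn
    rw [Function.mem_support] at hn
    exact ArithmeticFunction.vonMangoldt_ne_zero_iff.1 fun h ↦ hn (by simp [h])

lemma summable_primes_sq :
    Summable (fun p : Nat.Primes => log ((p : ℕ) : ℝ) / ((p : ℕ) : ℝ) ^ 2) := by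
  refine Summable.of_nonneg_of_le (fun p ↦ ?_) (fun p ↦ ?_) (summable_primes le_rfl)
  · have : (1 : ℝ) < (p : ℕ) := by exact_mod_cast p.2.one_lt
    exact div_nonneg (log_nonneg this.le) (by positivity)
  · have : (1 : ℝ) < (p : ℕ) := by exact_mod_cast p.2.one_lt
    have h2 : (0 : ℝ) < ((p : ℕ) : ℝ) ^ 2 - 1 := by nlinarith
    exact div_le_div_of_nonneg_left (log_nonneg this.le) h2 (by linarith)

end PrimeSum

namespace Numeric
open EulerMaclaurin PrimeSum

/-- The Bernoulli numbers `B₀, …, B₁₂`. -/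
def bernoulliValue : ℕ → ℚ
  | 0 => 1
  | 1 => -1 / 2
  | 2 => 1 / 6
  | 4 => -1 / 30
  | 6 => 1 / 42
  | 8 => -1 / 30
  | 10 => 5 / 66
  | 12 => -691 / 2730
  | _ => 0

lemma bernoulli_eq_bernoulliValue {j : ℕ} (hj : j < 13) : bernoulli j = bernoulliValue j := by
  have h0 := bernoulli_zero
  have h1 := bernoulli_one
  have h2 := bernoulli_two
  have odd (n : ℕ) : bernoulli (2 * n + 3) = 0 :=
    bernoulli_eq_zero_of_odd ⟨n + 1, by ring⟩ (by omega)
  have h3 := odd 0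
  have h5 := odd 1
  have h7 := odd 2
  have h9 := odd 3
  have h11 := odd 4
  norm_num at h3 h5 h7 h9 h11
  have h4 := sum_bernoulli 5
  norm_num [Finset.sum_range_succ, Nat.choose, h2, h3] at h4
  have h6 := sum_bernoulli 7
  norm_num [Finset.sum_range_succ, Nat.choose, h2, h3, h5] at h6
  have h8 := sum_bernoulli 9
  norm_num [Finset.sum_range_succ, Nat.choose, h2, h3, h5, h7] at h8
  have h10 := sum_bernoulli 11
  norm_num [Finset.sum_range_succ, Nat.choose, h2, h3, h5, h7, h9] at h10
  have h12 := sum_bernoulli 13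
  norm_num [Finset.sum_range_succ, Nat.choose, h2, h3, h5, h7, h9, h11] at h12
  interval_cases j <;> norm_num [bernoulliValue] <;> linarith

/-- A lower approximation of `10 ^ 30 * artanh (1 / d)`. -/
def artanhApprox (d : ℕ) : ℕ :=
  ∑ k ∈ Finset.range 32, 10 ^ 30 / ((2 * k + 1) * d ^ (2 * k + 1))

/-- A lower approximation of `log n`. -/
def logApprox (n : ℕ) : ℚ :=
  (∑ j ∈ Finset.range (n - 1), 2 * artanhApprox (2 * j + 3) : ℕ) / 10 ^ 30

lemma artanhApprox_bounds {d : ℕ} (hd : 3 ≤ d) :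
    (artanhApprox d : ℝ) / 10 ^ 30 ≤ 1 / 2 * log (((d : ℝ) + 1) / (d - 1)) ∧
      1 / 2 * log (((d : ℝ) + 1) / (d - 1)) ≤ artanhApprox d / 10 ^ 30 + 33 / 10 ^ 30 := by
  have hd' : (3 : ℝ) ≤ d := by exact_mod_cast hd
  have hx0 : 0 ≤ 1 / (d : ℝ) := by positivity
  have hx3 : 1 / (d : ℝ) ≤ 1 / 3 := by gcongr
  have h1 := sum_range_le_log_div hx0 (by linarith) 32
  have h2 := log_div_le_sum_range_add hx0 (by linarith) 32
  have harg : (1 + 1 / (d : ℝ)) / (1 - 1 / d) = ((d : ℝ) + 1) / (d - 1) := by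
    have : (d : ℝ) - 1 ≠ 0 := by linarith
    field_simp
  rw [harg] at h1 h2
  have hterm (k : ℕ) : (1 / (d : ℝ)) ^ (2 * k + 1) / (2 * k + 1) =
      ((10 ^ 30 : ℕ) : ℝ) / ((2 * k + 1) * d ^ (2 * k + 1) : ℕ) / 10 ^ 30 := by
    have : (d : ℝ) ≠ 0 := by linarith
    push_cast
    rw [one_div_pow]
    field_simp
    norm_num
  have hsum : (artanhApprox d : ℝ) / 10 ^ 30 = ∑ k ∈ Finset.range 32,
      ((10 ^ 30 / ((2 * k + 1) * d ^ (2 * k + 1)) : ℕ) : ℝ) / 10 ^ 30 := by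
    rw [artanhApprox, Nat.cast_sum, Finset.sum_div]
  have hle : (artanhApprox d : ℝ) / 10 ^ 30 ≤
      ∑ k ∈ Finset.range 32, (1 / (d : ℝ)) ^ (2 * k + 1) / (2 * k + 1) := by
    rw [hsum]
    refine Finset.sum_le_sum fun k _ ↦ ?_
    rw [hterm]
    gcongr
    exact Nat.cast_div_le
  have hge : ∑ k ∈ Finset.range 32, (1 / (d : ℝ)) ^ (2 * k + 1) / (2 * k + 1) ≤
      (artanhApprox d : ℝ) / 10 ^ 30 + 32 / 10 ^ 30 := by
    have : (32 : ℝ) / 10 ^ 30 = ∑ k ∈ Finset.range 32, 1 / 10 ^ 30 := by simp; norm_num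
    rw [hsum, this, ← Finset.sum_add_distrib]
    refine Finset.sum_le_sum fun k _ ↦ ?_
    rw [hterm, ← add_div]
    gcongr
    have := Nat.lt_floor_add_one (((10 ^ 30 : ℕ) : ℝ) / ((2 * k + 1) * d ^ (2 * k + 1) : ℕ))
    rw [Nat.floor_div_eq_div] at this
    exact this.le
  have htail : (1 / (d : ℝ)) ^ (2 * 32 + 1) / (1 - (1 / (d : ℝ)) ^ 2) ≤ 1 / 10 ^ 30 := by
    calc _ ≤ (1 / 3 : ℝ) ^ (2 * 32 + 1) / (1 - (1 / 3 : ℝ) ^ 2) := by gcongr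
      _ ≤ _ := by norm_num
  constructor
  · linarith
  · have : (33 : ℝ) / 10 ^ 30 = 32 / 10 ^ 30 + 1 / 10 ^ 30 := by norm_num
    linarith

lemma logApprox_succ (n : ℕ) :
    logApprox (n + 2) = logApprox (n + 1) + 2 * (artanhApprox (2 * n + 3) / 10 ^ 30) := by
  simp only [logApprox, Nat.add_sub_cancel, show n + 2 - 1 = n + 1 by omega,
    Finset.sum_range_succ]
  push_cast
  ring

lemma logApprox_bounds (n : ℕ) :
    (logApprox (n + 1) : ℝ) ≤ log (n + 1 : ℕ) ∧
      log (n + 1 : ℕ) ≤ logApprox (n + 1) + n * (66 / 10 ^ 30) := by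
  induction n with
  | zero => simp [logApprox]
  | succ n ih =>
    have h := artanhApprox_bounds (d := 2 * n + 3) (by omega)
    have hlog : log (n + 1 + 1 : ℕ) = log (n + 1 : ℕ) + log ((((2 * n + 3 : ℕ) : ℝ) + 1) /
        (((2 * n + 3 : ℕ) : ℝ) - 1)) := by
      rw [← log_mul (by positivity)]
      · congr 1
        push_cast
        have : (n : ℝ) + 1 ≠ 0 := by positivity
        rw [show (2 : ℝ) * n + 3 - 1 = 2 * (n + 1) by ring]
        field_simp
        ring
      · push_cast
        have : (0 : ℝ) < 2 * n + 3 - 1 := by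
          have : (0 : ℝ) ≤ n := by positivity
          linarith
        positivity
    rw [hlog, logApprox_succ]
    push_cast at *
    constructor <;> linarith [ih.1, ih.2, h.1, h.2]

lemma logApprox_le_log (n : ℕ) : (logApprox n : ℝ) ≤ log n := by
  rcases n with _ | n
  · simp [logApprox]
  · exact (logApprox_bounds n).1

lemma log_le_logApprox {n : ℕ} (hn : n ≤ 100) : log n ≤ logApprox n + 1 / 10 ^ 26 := by
  rcases n with _ | n
  · simp [logApprox]
  · refine (logApprox_bounds n).2.trans ?_
    have : (n : ℝ) ≤ 100 := by exact_mod_cast (by omega)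
    linarith

/-- The rational number `∑ j ∈ range 13, B_j / j! * c j / 100 ^ (r + j)`. -/
def bernoulliSum (r : ℕ) (c : ℕ → ℚ) : ℚ :=
  ∑ j ∈ Finset.range 13, bernoulliValue j / j ! * c j / 100 ^ (r + j)

/-- The rational Euler–Maclaurin approximation of order `12` at `100`. -/
def approx (r : ℕ) (a b : ℚ) : ℚ :=
  (∑ n ∈ Finset.range 100,
    ((coeffs r a b 1).1 * logApprox n + (coeffs r a b 1).2) / (n : ℚ) ^ (r + 1)) -
    (bernoulliSum r (fun j ↦ (coeffs r a b j).1) * logApprox 100 +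
      bernoulliSum r (fun j ↦ (coeffs r a b j).2))

/-- An error bound for `approx`. -/
def approxError (r : ℕ) (a b : ℚ) : ℚ :=
  errConst r a b 12 / 100 ^ (r + 11) +
    ((∑ n ∈ Finset.range 100, |(coeffs r a b 1).1| / (n : ℚ) ^ (r + 1)) +
      |bernoulliSum r (fun j ↦ (coeffs r a b j).1)|) / 10 ^ 26

lemma antidiff_eq (r : ℕ) (a b : ℚ) :
    antidiff r a b 12 (100 : ℕ) = bernoulliSum r (fun j ↦ (coeffs r a b j).1) * log (100 : ℕ) +
      bernoulliSum r (fun j ↦ (coeffs r a b j).2) := by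
  simp only [antidiff, bernoulliSum, logPow]
  push_cast
  rw [Finset.sum_mul, ← Finset.sum_add_distrib]
  refine Finset.sum_congr rfl fun j hj ↦ ?_
  rw [bernoulli_eq_bernoulliValue (Finset.mem_range.1 hj)]
  ring

theorem abs_sub_approx_le (r : ℕ) (a b : ℚ) {L : ℝ}
    (hL : Tendsto (fun M : ℕ ↦ (∑ n ∈ Finset.range M, logPow r a b 1 n) - logPow r a b 0 M)
      atTop (𝓝 L)) :
    |L - approx r a b| ≤ approxError r a b := by
  have h := abs_lim_sub_le r a b (k := 6) (q := r + 10) (by norm_num) (by ring)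
    (N := 100) (by norm_num) hL
  rw [show 2 * 6 = 12 from rfl, antidiff_eq] at h
  have hlog {n : ℕ} (hn : n ≤ 100) : |log n - logApprox n| ≤ 1 / 10 ^ 26 := by
    rw [abs_le]
    constructor
    · linarith [logApprox_le_log n, show (0 : ℝ) ≤ 1 / 10 ^ 26 by positivity]
    · linarith [log_le_logApprox hn]
  set A := bernoulliSum r (fun j ↦ (coeffs r a b j).1) with hA
  set B := bernoulliSum r (fun j ↦ (coeffs r a b j).2) with hB
  have hsum : |(∑ n ∈ Finset.range 100, logPow r a b 1 n) -
      ∑ n ∈ Finset.range 100, (((coeffs r a b 1).1 : ℝ) * logApprox n + (coeffs r a b 1).2) /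
        (n : ℝ) ^ (r + 1)| ≤
      (∑ n ∈ Finset.range 100, |((coeffs r a b 1).1 : ℝ)| / (n : ℝ) ^ (r + 1)) * (1 / 10 ^ 26) := by
    rw [← Finset.sum_sub_distrib, Finset.sum_mul]
    refine (Finset.abs_sum_le_sum_abs _ _).trans (Finset.sum_le_sum fun n hn ↦ ?_)
    rw [logPow, ← sub_div, show ((coeffs r a b 1).1 : ℝ) * log n + (coeffs r a b 1).2 -
      ((coeffs r a b 1).1 * logApprox n + (coeffs r a b 1).2) =
      (coeffs r a b 1).1 * (log n - logApprox n) by ring, abs_div, abs_mul,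
      abs_of_nonneg (by positivity : (0 : ℝ) ≤ (n : ℝ) ^ (r + 1)), div_mul_eq_mul_div]
    gcongr
    exact hlog (Finset.mem_range.1 hn).le
  have hanti : |(A : ℝ) * log (100 : ℕ) - A * logApprox 100| ≤ |(A : ℝ)| * (1 / 10 ^ 26) := by
    rw [← mul_sub, abs_mul]
    gcongr
    exact hlog le_rfl
  simp only [approx, approxError, ← hA, ← hB]
  push_cast
  rw [add_div]
  push_cast at h
  rw [abs_le] at *
  constructor <;> linarith [h.1, h.2, hsum.1, hsum.2, hanti.1, hanti.2]

lemma abs_gamma_sub_le : |eulerMascheroniConstant - approx 0 1 0| ≤ approxError 0 1 0 := by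
  refine abs_sub_approx_le 0 1 0 ?_
  rw [← tendsto_add_atTop_iff_nat 1]
  refine tendsto_eulerMascheroniSeq.congr fun n ↦ ?_
  rw [eulerMascheroniSeq, harmonic, Finset.sum_range_succ']
  simp [logPow, coeffs]

lemma tendsto_sum_sub {r : ℕ} (hr : r ≠ 0) {a b : ℚ} {f : ℕ → ℝ} (hf : Summable f)
    (h : ∀ n : ℕ, logPow r a b 1 n = f n) :
    Tendsto (fun M : ℕ ↦ (∑ n ∈ Finset.range M, logPow r a b 1 n) - logPow r a b 0 M)
      atTop (𝓝 (∑' n, f n)) := by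
  simp only [h]
  have h0 := tendsto_logPow (j := 0) (by simpa using hr) a b
  have h1 := hf.hasSum.tendsto_sum_nat.sub h0
  rwa [sub_zero] at h1

lemma abs_zeta_sub_le {r : ℕ} (hr : r ≠ 0) :
    |r * ∑' n : ℕ, 1 / (n : ℝ) ^ (r + 1) - approx r 0 (-1)| ≤ approxError r 0 (-1) := by
  refine abs_sub_approx_le r 0 (-1) ?_
  rw [← tsum_mul_left]
  refine tendsto_sum_sub hr ((summable_one_div_nat_pow.2 (by omega)).mul_left _) fun n ↦ ?_
  simp [logPow, coeffs, div_eq_mul_inv]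

lemma abs_logSum_sub_le {r : ℕ} (hr : r ≠ 0) :
    |(r : ℝ) ^ 2 * ∑' n : ℕ, log n / (n : ℝ) ^ (r + 1) - approx r (-r) (-1)| ≤
      approxError r (-r) (-1) := by
  refine abs_sub_approx_le r (-r) (-1) ?_
  rw [← tsum_mul_left]
  refine tendsto_sum_sub hr ((summable_log (by omega)).mul_left _) fun n ↦ ?_
  simp [logPow, coeffs]
  ring

/-- The sum of `log p / (p ^ s - 1)` over the primes. -/
noncomputable def primeSum (s : ℕ) : ℝ :=
  ∑' p : Nat.Primes, log (p : ℕ) / (((p : ℕ) : ℝ) ^ s - 1)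

lemma primeSum_mem_Icc {r : ℕ} (hr : r ≠ 0) {lo hi : ℚ} (hlo : 0 ≤ lo) (hhi : 0 ≤ hi)
    (h1 : lo * (r * (approx r 0 (-1) + approxError r 0 (-1))) ≤
      approx r (-r) (-1) - approxError r (-r) (-1))
    (h2 : approx r (-r) (-1) + approxError r (-r) (-1) ≤
      hi * (r * (approx r 0 (-1) - approxError r 0 (-1)))) :
    primeSum (r + 1) ∈ Set.Icc (lo : ℝ) hi := by
  have hr0 : (0 : ℝ) < r := by positivity
  have hs : 2 ≤ r + 1 := by omega
  have hZ : 0 < ∑' n : ℕ, 1 / (n : ℝ) ^ (r + 1) :=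
    (summable_one_div_nat_pow.2 (by omega)).tsum_pos (fun n ↦ by positivity) 1 (by simp)
  have hD := tsum_vonMangoldt_mul hs
  rw [← tsum_primes hs] at hD
  have hz := abs_le.1 (abs_zeta_sub_le hr)
  have hd := abs_le.1 (abs_logSum_sub_le hr)
  rw [← hD] at hd
  set Z := ∑' n : ℕ, 1 / (n : ℝ) ^ (r + 1)
  set T := ∑' p : Nat.Primes, log (p : ℕ) / (((p : ℕ) : ℝ) ^ (r + 1) - 1)
  replace h1 : (lo : ℝ) * (r * (approx r 0 (-1) + approxError r 0 (-1))) ≤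
      approx r (-r) (-1) - approxError r (-r) (-1) := by exact_mod_cast h1
  replace h2 : (approx r (-r) (-1) : ℝ) + approxError r (-r) (-1) ≤
      hi * (r * (approx r 0 (-1) - approxError r 0 (-1))) := by exact_mod_cast h2
  replace hlo : (0 : ℝ) ≤ lo := by exact_mod_cast hlo
  replace hhi : (0 : ℝ) ≤ hi := by exact_mod_cast hhi
  have hc : 0 < (r : ℝ) ^ 2 * Z := by positivity
  have h3 : (lo : ℝ) * (r * (r * Z)) ≤
      lo * (r * (approx r 0 (-1) + approxError r 0 (-1))) := by
    gcongr
    linarith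
  have h4 : (hi : ℝ) * (r * (approx r 0 (-1) - approxError r 0 (-1))) ≤ hi * (r * (r * Z)) := by
    gcongr
    linarith
  change T ∈ _
  constructor
  · refine le_of_mul_le_mul_right ?_ hc
    linarith
  · refine le_of_mul_le_mul_right ?_ hc
    linarith

lemma primeSum_two_mem : primeSum 2 ∈ Set.Icc
    ((0.5699609930945328063998382 : ℚ) : ℝ) (0.5699609930945328063998906 : ℚ) :=
  primeSum_mem_Icc (r := 1) (by norm_num) (by norm_num) (by norm_num)
    (by decide +kernel) (by decide +kernel)

lemma primeSum_four_mem : primeSum 4 ∈ Set.Icc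
    ((0.0636697649553711264961985 : ℚ) : ℝ) (0.0636697649553711264961988 : ℚ) :=
  primeSum_mem_Icc (r := 3) (by norm_num) (by norm_num) (by norm_num)
    (by decide +kernel) (by decide +kernel)

lemma primeSum_six_mem : primeSum 6 ∈ Set.Icc
    ((0.0126330690325110608238922 : ℚ) : ℝ) (0.0126330690325110608238924 : ℚ) :=
  primeSum_mem_Icc (r := 5) (by norm_num) (by norm_num) (by norm_num)
    (by decide +kernel) (by decide +kernel)

lemma primeSum_ten_mem : primeSum 10 ∈ Set.Icc
    ((0.0006963404452840204365952 : ℚ) : ℝ) (0.0006963404452840204365954 : ℚ) :=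
  primeSum_mem_Icc (r := 9) (by norm_num) (by norm_num) (by norm_num)
    (by decide +kernel) (by decide +kernel)

/-- The remainder of `1 / q` after its expansion into `1 / (q ^ k - 1)` for `k = 1, 2, 3, 5`. -/
def remainder {K : Type*} [Field K] (q : K) : K :=
  (q ^ 3 + q ^ 2 - 1) /
    (q * (q - 1) * (q + 1) * (q ^ 2 + q + 1) * (q ^ 4 + q ^ 3 + q ^ 2 + q + 1))

lemma one_div_eq_add_remainder {q : ℝ} (hq : 1 < q) :
    1 / q = 1 / (q - 1) - 1 / (q ^ 2 - 1) - 1 / (q ^ 3 - 1) - 1 / (q ^ 5 - 1) + remainder q := by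
  have h0 : q - 1 ≠ 0 := by linarith
  have h1 : q + 1 ≠ 0 := by linarith
  have h2 : q ^ 2 + q + 1 ≠ 0 := by positivity
  have h3 : q ^ 4 + q ^ 3 + q ^ 2 + q + 1 ≠ 0 := by positivity
  rw [show q ^ 2 - 1 = (q - 1) * (q + 1) by ring,
    show q ^ 3 - 1 = (q - 1) * (q ^ 2 + q + 1) by ring,
    show q ^ 5 - 1 = (q - 1) * (q ^ 4 + q ^ 3 + q ^ 2 + q + 1) by ring, remainder]
  field_simp
  ring

lemma remainder_nonneg {q : ℝ} (hq : 1 < q) : 0 ≤ remainder q := by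
  have h0 : 0 < q - 1 := by linarith
  have h1 : 0 ≤ q ^ 3 + q ^ 2 - 1 := by nlinarith [pow_pos (by linarith : 0 < q) 3]
  exact div_nonneg h1 (by positivity)

lemma remainder_le {q : ℝ} (hq : 10 ^ 4 ≤ q) : remainder q ≤ 3 / 10 ^ 4 / (q ^ 5 - 1) := by
  have h0 : 0 < q - 1 := by linarith
  rw [show q ^ 5 - 1 = (q - 1) * (q ^ 4 + q ^ 3 + q ^ 2 + q + 1) by ring, remainder,
    div_le_div_iff₀ (by positivity) (by positivity)]
  have h1 : q ^ 3 + q ^ 2 - 1 ≤ 3 / 10 ^ 4 * (q * (q + 1) * (q ^ 2 + q + 1)) := by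
    have h2 : 0 ≤ (q - 10 ^ 4) * q ^ 3 := mul_nonneg (by linarith) (by positivity)
    nlinarith [pow_pos (by linarith : 0 < q) 3]
  calc _ = (q ^ 3 + q ^ 2 - 1) * ((q - 1) * (q ^ 4 + q ^ 3 + q ^ 2 + q + 1)) := rfl
    _ ≤ 3 / 10 ^ 4 * (q * (q + 1) * (q ^ 2 + q + 1)) *
        ((q - 1) * (q ^ 4 + q ^ 3 + q ^ 2 + q + 1)) := by gcongr
    _ = _ := by ring

lemma one_lt_prime_sq (p : Nat.Primes) : (1 : ℝ) < ((p : ℕ) : ℝ) ^ 2 :=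
  one_lt_pow₀ (by exact_mod_cast p.2.one_lt) two_ne_zero

lemma log_div_prime_sq_eq (p : Nat.Primes) :
    log (p : ℕ) / ((p : ℕ) : ℝ) ^ 2 = log (p : ℕ) / (((p : ℕ) : ℝ) ^ 2 - 1) -
      log (p : ℕ) / (((p : ℕ) : ℝ) ^ 4 - 1) - log (p : ℕ) / (((p : ℕ) : ℝ) ^ 6 - 1) -
      log (p : ℕ) / (((p : ℕ) : ℝ) ^ 10 - 1) + log (p : ℕ) * remainder (((p : ℕ) : ℝ) ^ 2) := by
  have h := congrArg (log (p : ℕ) * ·) (one_div_eq_add_remainder (one_lt_prime_sq p))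
  simp only [← pow_mul] at h
  norm_num only at h
  linear_combination h

lemma hasSum_remainder :
    HasSum (fun p : Nat.Primes ↦ log (p : ℕ) * remainder (((p : ℕ) : ℝ) ^ 2))
      ((∑' p : Nat.Primes, log ((p : ℕ) : ℝ) / ((p : ℕ) : ℝ) ^ 2) -
        (primeSum 2 - primeSum 4 - primeSum 6 - primeSum 10)) := by
  have h := (((summable_primes (s := 2) (by norm_num)).hasSum.sub
    (summable_primes (s := 4) (by norm_num)).hasSum).sub
    (summable_primes (s := 6) (by norm_num)).hasSum).sub
    (summable_primes (s := 10) (by norm_num)).hasSum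
  refine (summable_primes_sq.hasSum.sub h).congr_fun fun p ↦ ?_
  rw [log_div_prime_sq_eq]
  ring

/-- The primes below `100`. -/
def smallPrimes : Finset Nat.Primes := (Finset.range 100).subtype Nat.Prime

lemma hundred_le_of_notMem {p : Nat.Primes} (hp : p ∉ smallPrimes) : 100 ≤ (p : ℕ) := by
  by_contra! h
  exact hp (Finset.mem_subtype.2 (Finset.mem_range.2 h))


lemma sum_smallPrimes_mem {f : ℕ → ℝ} {w : ℕ → ℚ} (hf : ∀ n, f n = log n * w n)
    (hw : ∀ n ∈ (Finset.range 100).filter Nat.Prime, 0 ≤ w n) {lo hi : ℚ}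
    (h1 : lo ≤ ∑ n ∈ Finset.range 100 with n.Prime, logApprox n * w n)
    (h2 : ∑ n ∈ Finset.range 100 with n.Prime, (logApprox n + 1 / 10 ^ 26) * w n ≤ hi) :
    ∑ p ∈ smallPrimes, f (p : ℕ) ∈ Set.Icc (lo : ℝ) hi := by
  have hsum : ∑ p ∈ smallPrimes, f (p : ℕ) = ∑ n ∈ Finset.range 100 with n.Prime, f n :=
    Finset.sum_subtype_eq_sum_filter f
  rw [hsum]
  replace hw : ∀ n ∈ (Finset.range 100).filter Nat.Prime, (0 : ℝ) ≤ w n :=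
    fun n hn ↦ by exact_mod_cast hw n hn
  replace h1 : (lo : ℝ) ≤ ∑ n ∈ Finset.range 100 with n.Prime, (logApprox n : ℝ) * w n := by
    exact_mod_cast h1
  replace h2 : ∑ n ∈ Finset.range 100 with n.Prime,
      ((logApprox n : ℝ) + 1 / 10 ^ 26) * (w n : ℝ) ≤ (hi : ℝ) := by
    rw [← Rat.cast_le (K := ℝ)] at h2
    push_cast at h2
    exact h2
  constructor
  · refine h1.trans (Finset.sum_le_sum fun n hn ↦ ?_)
    rw [hf]
    exact mul_le_mul_of_nonneg_right (logApprox_le_log n) (hw n hn)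
  · refine (Finset.sum_le_sum fun n hn ↦ ?_).trans h2
    rw [hf]
    have hn' := Finset.mem_range.1 (Finset.mem_filter.1 hn).1
    exact mul_le_mul_of_nonneg_right (log_le_logApprox hn'.le) (hw n hn)

lemma sum_remainder_smallPrimes_mem :
    ∑ p ∈ smallPrimes, log (p : ℕ) * remainder (((p : ℕ) : ℝ) ^ 2) ∈ Set.Icc
      ((0.0001292907073978635546350 : ℚ) : ℝ) (0.0001292907073978635546351 : ℚ) :=
  sum_smallPrimes_mem (f := fun n ↦ log n * remainder ((n : ℝ) ^ 2))
    (w := fun n ↦ remainder ((n : ℚ) ^ 2)) (fun n ↦ by simp [remainder])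
    (by decide +kernel) (by decide +kernel) (by decide +kernel)

lemma sum_smallPrimes_ten_mem :
    ∑ p ∈ smallPrimes, log (p : ℕ) / (((p : ℕ) : ℝ) ^ 10 - 1) ∈ Set.Icc
      ((0.0006963404452840202872750 : ℚ) : ℝ) (0.0006963404452840202872751 : ℚ) :=
  sum_smallPrimes_mem (f := fun n ↦ log n / ((n : ℝ) ^ 10 - 1))
    (w := fun n ↦ 1 / ((n : ℚ) ^ 10 - 1)) (fun n ↦ by simp [div_eq_mul_inv])
    (by decide +kernel) (by decide +kernel) (by decide +kernel)

lemma tsum_log_div_sq_mem :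
    ∑' p : Nat.Primes, log ((p : ℕ) : ℝ) / ((p : ℕ) : ℝ) ^ 2 ∈ Set.Icc
      (0.4930911093687644621977 : ℝ) 0.4930911093687644621980 := by
  have hlog (p : Nat.Primes) : 0 ≤ log (p : ℕ) := log_natCast_nonneg _
  have hlow := sum_le_hasSum smallPrimes
    (fun p _ ↦ mul_nonneg (hlog p) (remainder_nonneg (one_lt_prime_sq p))) hasSum_remainder
  have hupp := sum_le_hasSum smallPrimes (fun p hp ↦ ?_)
    (((summable_primes (s := 10) (by norm_num)).hasSum.mul_left (3 / 10 ^ 4)).sub hasSum_remainder)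
  · rw [Finset.sum_sub_distrib, ← Finset.mul_sum] at hupp
    have h2 := primeSum_two_mem
    have h4 := primeSum_four_mem
    have h6 := primeSum_six_mem
    have h10 := primeSum_ten_mem
    have hr := sum_remainder_smallPrimes_mem
    have hs := sum_smallPrimes_ten_mem.1
    change _ ≤ 3 / 10 ^ 4 * primeSum 10 - _ at hupp
    simp only [Set.mem_Icc] at *
    push_cast at *
    constructor <;> linarith [h2.1, h2.2, h4.1, h4.2, h6.1, h6.2, h10.1, h10.2, hr.1, hr.2]
  · have hp' : (100 : ℝ) ≤ (p : ℕ) := by exact_mod_cast hundred_le_of_notMem hp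
    have h := mul_le_mul_of_nonneg_left
      (remainder_le (q := ((p : ℕ) : ℝ) ^ 2) (by nlinarith)) (hlog p)
    rw [← pow_mul] at h
    norm_num only at h
    refine sub_nonneg.2 (h.trans_eq ?_)
    ring

lemma gamma_mem : eulerMascheroniConstant ∈ Set.Icc
    ((0.5772156649015328606064 : ℚ) : ℝ) (0.5772156649015328606067 : ℚ) := by
  have h := abs_le.1 abs_gamma_sub_le
  have h1 : (0.5772156649015328606064 : ℚ) ≤ approx 0 1 0 - approxError 0 1 0 := by decide +kernel
  have h2 : approx 0 1 0 + approxError 0 1 0 ≤ (0.5772156649015328606067 : ℚ) := by decide +kernel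
  have h1' : ((0.5772156649015328606064 : ℚ) : ℝ) ≤ approx 0 1 0 - approxError 0 1 0 := by
    exact_mod_cast h1
  have h2' : approx 0 1 0 + approxError 0 1 0 ≤ ((0.5772156649015328606067 : ℚ) : ℝ) := by
    exact_mod_cast h2
  constructor <;> linarith

lemma exp_gamma_mem : exp eulerMascheroniConstant ∈ Set.Icc
    (1.781072417990197985236 : ℝ) 1.781072417990197985237 := by
  have hg := gamma_mem
  push_cast at hg
  constructor
  · refine le_trans ?_ ((sum_le_exp_of_nonneg (by norm_num) 24).trans (exp_le_exp.2 hg.1))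
    norm_num [Finset.sum_range_succ, Nat.factorial]
  · refine ((exp_le_exp.2 hg.2).trans
      (exp_bound' (by norm_num) (by norm_num) (n := 24) (by norm_num))).trans ?_
    norm_num [Finset.sum_range_succ, Nat.factorial]

end Numeric

end

/-- The constant `Cb = 1 + e^γ·∑_{p prime} (ln p)/p² = 1.8782309744528944880…`,
where the prime sum converges. -/
theorem Cb_bounds :
    Summable (fun p : Nat.Primes => log ((p : ℕ) : ℝ) / ((p : ℕ) : ℝ) ^ 2) ∧
    1.8782309744528944880 <
      1 + exp eulerMascheroniConstant *
        ∑' p : Nat.Primes, log ((p : ℕ) : ℝ) / ((p : ℕ) : ℝ) ^ 2 ∧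
    1 + exp eulerMascheroniConstant *
        ∑' p : Nat.Primes, log ((p : ℕ) : ℝ) / ((p : ℕ) : ℝ) ^ 2 <
      1.8782309744528944881 := by
  have hE := Numeric.exp_gamma_mem
  have hS := Numeric.tsum_log_div_sq_mem
  refine ⟨PrimeSum.summable_primes_sq, ?_, ?_⟩
  · have h := mul_le_mul hE.1 hS.1 (by norm_num) (exp_pos _).le
    norm_num at h ⊢
    linarith
  · have h := mul_le_mul hE.2 hS.2 (le_trans (by norm_num) hS.1) (by norm_num)
    norm_num at h ⊢
    linarith
end

section
/- The constant Ca = 1 + e^{2γ}·( 2·∑_{p prime} (ln²p)/p² − ∑_{p prime} (ln²p)/p³ ) satisfies 5.2292502967625442529 < Ca < 5.2292502967625442530, where γ is the Euler–Mascheroni constant and both prime sums converge. -/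
open Real

/-- The rational coefficients of the derivative of `(a + b log x + c log² x) / x ^ r`,
written over `x ^ (r + 1)`. -/
def logPolyDeriv (r : ℕ) (t : ℚ × ℚ × ℚ) : ℚ × ℚ × ℚ :=
  (t.2.1 - r * t.1, 2 * t.2.2 - r * t.2.1, -r * t.2.2)

/-- The coefficients of the `k`-th derivative of `(a + b log x + c log² x) / x ^ r`,
written over `x ^ (r + k)`. -/
def logPolyIter (r : ℕ) (t : ℚ × ℚ × ℚ) : ℕ → ℚ × ℚ × ℚ
  | 0 => t
  | k + 1 => logPolyDeriv (r + k) (logPolyIter r t k)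

/-- The function `(a + b log x + c log² x) / x ^ r`. -/
noncomputable def logPoly (r : ℕ) (t : ℚ × ℚ × ℚ) (x : ℝ) : ℝ :=
  (t.1 + t.2.1 * log x + t.2.2 * log x ^ 2) / x ^ r

theorem hasDerivAt_logPoly (r : ℕ) (t : ℚ × ℚ × ℚ) {x : ℝ} (hx : 0 < x) :
    HasDerivAt (logPoly r t) (logPoly (r + 1) (logPolyDeriv r t) x) x := by
  have h1 := Real.hasDerivAt_log hx.ne'
  have h2 := (((h1.const_mul (t.2.1 : ℝ)).const_add (t.1 : ℝ)).add
    ((h1.pow 2).const_mul (t.2.2 : ℝ))).div (hasDerivAt_pow r x) (pow_ne_zero r hx.ne')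
  convert! h2 using 1
  simp only [logPoly, logPolyDeriv, Pi.add_apply]
  push_cast
  rcases r with _ | r
  · field_simp
    simp
    ring
  · field_simp
    simp
    ring

theorem eulerMaclaurin_unit_step {h : ℕ → ℝ → ℝ} {n : ℝ}
    (hd : ∀ k, ∀ x, n ≤ x → HasDerivAt (h k) (h (k + 1) x) x) {K : ℕ} (hK : 1 ≤ K) :
    h 1 n = ∑ k ∈ Finset.range (K + 1),
        (bernoulli k / k.factorial : ℝ) * (h k (n + 1) - h k n) +
      (-1) ^ (K + 1) *
        ∫ t in (0 : ℝ)..1, bernoulliFun K t / K.factorial * h (K + 1) (n + t) := by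
  have hd' (k : ℕ) (t : ℝ) (ht : t ∈ Set.uIcc (0 : ℝ) 1) :
      HasDerivAt (fun t ↦ h k (n + t)) (h (k + 1) (n + t)) t := by
    rw [Set.uIcc_of_le zero_le_one] at ht
    exact (hd k (n + t) (by linarith [ht.1])).comp_const_add n t
  have hc (k : ℕ) : ContinuousOn (fun t ↦ h k (n + t)) (Set.uIcc (0 : ℝ) 1) :=
    fun t ht ↦ (hd' k t ht).continuousAt.continuousWithinAt
  have hB (k : ℕ) (t : ℝ) : HasDerivAt (fun t ↦ bernoulliFun (k + 1) t / (k + 1).factorial)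
      (bernoulliFun k t / k.factorial) t := by
    convert! (hasDerivAt_bernoulliFun (k + 1) t).div_const ((k + 1).factorial : ℝ) using 1
    rw [Nat.factorial_succ]
    push_cast
    field_simp
  have hparts (k : ℕ) :
      ∫ t in (0 : ℝ)..1, bernoulliFun k t / k.factorial * h (k + 1) (n + t) =
        bernoulliFun (k + 1) 1 / (k + 1).factorial * h (k + 1) (n + 1) -
        bernoulliFun (k + 1) 0 / (k + 1).factorial * h (k + 1) n -
        ∫ t in (0 : ℝ)..1, bernoulliFun (k + 1) t / (k + 1).factorial * h (k + 2) (n + t) := by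
    have := intervalIntegral.integral_mul_deriv_eq_deriv_mul (a := (0 : ℝ)) (b := 1)
      (fun t ht ↦ hd' (k + 1) t ht) (fun t _ ↦ hB k t)
      (hc (k + 2)).intervalIntegrable
      (((continuous_bernoulliFun k).div_const _).intervalIntegrable 0 1)
    simp only [add_zero] at this
    rw [show (fun t ↦ bernoulliFun k t / k.factorial * h (k + 1) (n + t)) =
      fun t ↦ h (k + 1) (n + t) * (bernoulliFun k t / k.factorial) from
        funext fun t ↦ mul_comm _ _, this,
      show (fun t ↦ h (k + 1 + 1) (n + t) * (bernoulliFun (k + 1) t / (k + 1).factorial)) =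
        fun t ↦ bernoulliFun (k + 1) t / (k + 1).factorial * h (k + 2) (n + t) from
        funext fun t ↦ mul_comm _ _]
    ring
  have h0 : ∫ t in (0 : ℝ)..1, bernoulliFun 0 t / Nat.factorial 0 * h (0 + 1) (n + t) =
      h 0 (n + 1) - h 0 n := by
    simp only [bernoulliFun_zero, Nat.factorial_zero, Nat.cast_one, div_one, one_mul]
    rw [intervalIntegral.integral_eq_sub_of_hasDerivAt (fun t ht ↦ hd' 0 t ht)
      (hc 1).intervalIntegrable]
    simp
  induction K, hK using Nat.le_induction with
  | base =>
    rw [hparts 0] at h0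
    simp only [Finset.sum_range_succ, Finset.sum_range_zero]
    simp [bernoulliFun_one] at h0 ⊢
    linarith
  | succ K hK ih =>
    rw [hparts K, bernoulliFun_endpoints_eq_of_ne_one (by omega), bernoulliFun_eval_zero] at ih
    have hodd : (-1 : ℝ) ^ (K + 1) * (bernoulli (K + 1) : ℝ) = bernoulli (K + 1) := by
      rcases Nat.even_or_odd (K + 1) with he | ho
      · simp [he.neg_one_pow]
      · rw [bernoulli_eq_zero_of_odd ho (by omega)]
        simp
    rw [Finset.sum_range_succ, ih]
    rw [pow_succ (-1 : ℝ) (K + 1)]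
    linear_combination (h (K + 1) (n + 1) - h (K + 1) n) / (K + 1).factorial * hodd

theorem abs_bernoulliFun_le {k : ℕ} (hk : k ≠ 0) {x : ℝ} (hx : x ∈ Set.Icc (0 : ℝ) 1) :
    |bernoulliFun (2 * k) x| ≤ |(bernoulli (2 * k) : ℝ)| := by
  have h1 := hasSum_one_div_nat_pow_mul_cos hk hx
  have h0 := hasSum_one_div_nat_pow_mul_cos hk (x := 0) (by simp)
  have hle := norm_tsum_le_tsum_norm (f := fun n : ℕ ↦ 1 / (n : ℝ) ^ (2 * k) * cos (2 * π * n * x))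
    h1.summable.norm
  have hle2 : ∑' n : ℕ, ‖1 / (n : ℝ) ^ (2 * k) * cos (2 * π * n * x)‖ ≤
      ∑' n : ℕ, 1 / (n : ℝ) ^ (2 * k) * cos (2 * π * n * 0) := by
    refine h1.summable.norm.tsum_le_tsum (fun n ↦ ?_) h0.summable
    rw [norm_mul, mul_zero, cos_zero, mul_one, Real.norm_of_nonneg (by positivity)]
    exact mul_le_of_le_one_right (by positivity) (abs_cos_le_one _)
  have hle3 := (hle.trans hle2).trans (le_abs_self _)
  rw [h1.tsum_eq, h0.tsum_eq] at hle3
  have e (y : ℝ) : (Polynomial.map (algebraMap ℚ ℝ) (Polynomial.bernoulli (2 * k))).eval y =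
    bernoulliFun (2 * k) y := rfl
  rw [e, e, bernoulliFun_eval_zero, Real.norm_eq_abs, abs_mul, abs_mul] at hle3
  refine le_of_mul_le_mul_left hle3 (abs_pos.mpr ?_)
  positivity

theorem log_sq_le_self {x : ℝ} (hx : 1 ≤ x) : log x ^ 2 ≤ x := by
  have hx0 : 0 < x := by linarith
  have hl0 : 0 ≤ log x := log_nonneg hx
  have hs := sqrt_pos.mpr hx0
  have h := log_le_sub_one_of_pos (sqrt_pos.mpr hs)
  rw [log_sqrt hs.le, log_sqrt hx0.le] at h
  have h1 : √(√x) ^ 2 = √x := sq_sqrt hs.le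
  have h2 : √x ^ 2 = x := sq_sqrt hx0.le
  calc log x ^ 2 ≤ √x ^ 2 :=
        pow_le_pow_left₀ hl0 (by nlinarith [sq_nonneg (√(√x) - 2)]) 2
    _ = x := h2

theorem abs_logPoly_le (r : ℕ) (t : ℚ × ℚ × ℚ) {x : ℝ} (hx : 1 ≤ x) :
    |logPoly (r + 1) t x| ≤ ((|t.1| + |t.2.1| + |t.2.2| : ℚ) : ℝ) / x ^ r := by
  have hx0 : 0 < x := by linarith
  have hl0 : 0 ≤ log x := log_nonneg hx
  have hl1 : log x ≤ x := (log_le_sub_one_of_pos hx0).trans (by linarith)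
  have hl2 := log_sq_le_self hx
  rw [logPoly, abs_div, abs_of_pos (pow_pos hx0 (r + 1)), div_le_div_iff₀ (by positivity)
    (by positivity), pow_succ]
  have h1 : |(t.1 : ℝ) + t.2.1 * log x + t.2.2 * log x ^ 2| ≤
      |(t.1 : ℝ)| * x + |(t.2.1 : ℝ)| * x + |(t.2.2 : ℝ)| * x := by
    refine (abs_add_three _ _ _).trans ?_
    rw [abs_mul, abs_mul, abs_of_nonneg hl0, abs_of_nonneg (sq_nonneg (log x))]
    gcongr
    exact le_mul_of_one_le_right (abs_nonneg _) hx
  push_cast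
  calc _ ≤ _ := mul_le_mul_of_nonneg_right h1 (by positivity)
    _ = _ := by ring

theorem one_div_pow_succ_le (m : ℕ) (hm : m ≠ 0) {x : ℝ} (hx : 1 < x) :
    1 / x ^ (m + 1) ≤ 1 / m * (1 / (x - 1) ^ m - 1 / x ^ m) := by
  have hx0 : 0 < x - 1 := by linarith
  have hx1 : 0 < x := by linarith
  have hm0 : (0 : ℝ) < m := by positivity
  have h := one_add_mul_le_pow (a := 1 / (x - 1)) (by have : 0 < 1 / (x - 1) := by positivity
                                                      linarith) m
  have h2 : 1 + 1 / (x - 1) = x / (x - 1) := by field_simp; ring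
  rw [h2, div_pow] at h
  have h3 : (m : ℝ) / x ≤ m * (1 / (x - 1)) := by
    rw [mul_one_div]
    gcongr
    linarith
  have h4 : (m : ℝ) / x + 1 ≤ x ^ m / (x - 1) ^ m := by linarith
  have h5 : ((m : ℝ) / x + 1) / x ^ m ≤ 1 / (x - 1) ^ m := by
    rw [div_le_iff₀ (by positivity)]
    calc _ ≤ _ := h4
      _ = _ := by ring
  have h6 : 1 / x ^ (m + 1) = 1 / m * (((m : ℝ) / x + 1) / x ^ m - 1 / x ^ m) := by
    field_simp
    ring
  rw [h6]
  gcongr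

/-- The Euler–Maclaurin antidifference of order `K` of the derivative of `logPoly r t`. -/
noncomputable def emPrimitive (r : ℕ) (t : ℚ × ℚ × ℚ) (K : ℕ) (x : ℝ) : ℝ :=
  ∑ k ∈ Finset.range (K + 1),
    (bernoulli k / k.factorial : ℝ) * logPoly (r + k) (logPolyIter r t k) x

/-- The sum of the absolute values of a coefficient triple. -/
def tripleNorm (t : ℚ × ℚ × ℚ) : ℚ := |t.1| + |t.2.1| + |t.2.2|

/-- The error constant in the Euler–Maclaurin formula for `logPoly`. -/
noncomputable def emConst (r : ℕ) (t : ℚ × ℚ × ℚ) (K : ℕ) : ℝ :=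
  |(bernoulli K : ℝ)| / K.factorial * tripleNorm (logPolyIter r t (K + 1)) / (r + K - 1 : ℕ)

theorem abs_logPoly_sub_emPrimitive_le (r : ℕ) (t : ℚ × ℚ × ℚ) {k : ℕ} (hk : k ≠ 0) {n : ℝ}
    (hn : 1 < n) :
    |logPoly (r + 1) (logPolyIter r t 1) n -
        (emPrimitive r t (2 * k) (n + 1) - emPrimitive r t (2 * k) n)| ≤
      emConst r t (2 * k) * (1 / (n - 1) ^ (r + 2 * k - 1) - 1 / n ^ (r + 2 * k - 1)) := by
  have hn0 : 0 < n := by linarith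
  have h := eulerMaclaurin_unit_step (h := fun k ↦ logPoly (r + k) (logPolyIter r t k)) (n := n)
    (fun k x hx ↦ hasDerivAt_logPoly (r + k) _ (hn0.trans_le hx)) (K := 2 * k) (by omega)
  have h2 : logPoly (r + 1) (logPolyIter r t 1) n -
      (emPrimitive r t (2 * k) (n + 1) - emPrimitive r t (2 * k) n) = (-1) ^ (2 * k + 1) *
        ∫ s in (0 : ℝ)..1, bernoulliFun (2 * k) s / (2 * k).factorial *
          logPoly (r + (2 * k + 1)) (logPolyIter r t (2 * k + 1)) (n + s) := by
    rw [h]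
    simp only [emPrimitive]
    rw [← Finset.sum_sub_distrib]
    simp only [← mul_sub]
    ring
  rw [h2, abs_mul, abs_pow, abs_neg, abs_one, one_pow, one_mul]
  have hm : r + 2 * k - 1 + 1 = r + 2 * k := by omega
  have hb : ∀ s ∈ Set.uIoc (0 : ℝ) 1, ‖bernoulliFun (2 * k) s / (2 * k).factorial *
          logPoly (r + (2 * k + 1)) (logPolyIter r t (2 * k + 1)) (n + s)‖ ≤
        |(bernoulli (2 * k) : ℝ)| / (2 * k).factorial *
          (tripleNorm (logPolyIter r t (2 * k + 1)) / n ^ (r + 2 * k - 1 + 1)) := by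
    intro s hs
    rw [Set.uIoc_of_le zero_le_one] at hs
    rw [norm_mul, norm_div, Real.norm_eq_abs, Real.norm_eq_abs, Real.norm_eq_abs, Nat.abs_cast, hm]
    have hl := abs_logPoly_le (r + 2 * k) (logPolyIter r t (2 * k + 1)) (x := n + s)
      (by linarith [hs.1])
    have hT : (0 : ℝ) ≤ tripleNorm (logPolyIter r t (2 * k + 1)) := by
      rw [tripleNorm]
      positivity
    refine mul_le_mul ?_ (hl.trans ?_) (abs_nonneg _) (by positivity)
    · refine div_le_div_of_nonneg_right ?_ (by positivity)
      exact abs_bernoulliFun_le hk ⟨hs.1.le, hs.2⟩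
    · change (tripleNorm (logPolyIter r t (2 * k + 1)) : ℝ) / _ ≤ _
      gcongr
      linarith [hs.1]
  have hI := intervalIntegral.norm_integral_le_of_norm_le_const hb
  rw [Real.norm_eq_abs, sub_zero, abs_one, mul_one] at hI
  refine hI.trans ?_
  have hp := one_div_pow_succ_le (r + 2 * k - 1) (by omega) hn
  have hT : (0 : ℝ) ≤ tripleNorm (logPolyIter r t (2 * k + 1)) := by
    rw [tripleNorm]
    positivity
  calc _ = |(bernoulli (2 * k) : ℝ)| / (2 * k).factorial *
          tripleNorm (logPolyIter r t (2 * k + 1)) * (1 / n ^ (r + 2 * k - 1 + 1)) := by ring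
    _ ≤ _ := mul_le_mul_of_nonneg_left hp (by positivity)
    _ = _ := by rw [emConst]; ring

theorem emConst_nonneg (r : ℕ) (t : ℚ × ℚ × ℚ) (K : ℕ) : 0 ≤ emConst r t K := by
  rw [emConst, tripleNorm]
  positivity

theorem abs_sum_sub_emPrimitive_le (r : ℕ) (t : ℚ × ℚ × ℚ) {k : ℕ} (hk : k ≠ 0) {N M : ℕ}
    (hN : 2 ≤ N) (hM : N ≤ M) :
    |∑ n ∈ Finset.Ico N M, logPoly (r + 1) (logPolyIter r t 1) n -
        (emPrimitive r t (2 * k) M - emPrimitive r t (2 * k) N)| ≤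
      emConst r t (2 * k) * (1 / ((N : ℝ) - 1) ^ (r + 2 * k - 1)) := by
  have key : |∑ n ∈ Finset.Ico N M, logPoly (r + 1) (logPolyIter r t 1) n -
        (emPrimitive r t (2 * k) M - emPrimitive r t (2 * k) N)| ≤
      emConst r t (2 * k) * (1 / ((N : ℝ) - 1) ^ (r + 2 * k - 1) -
        1 / ((M : ℝ) - 1) ^ (r + 2 * k - 1)) := by
    induction M, hM using Nat.le_induction with
    | base => simp
    | succ M hM ih =>
      have h1 : (1 : ℝ) < M := by exact_mod_cast (by omega : 1 < M)
      have h := abs_logPoly_sub_emPrimitive_le r t hk h1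
      rw [Finset.sum_Ico_succ_top hM]
      push_cast
      rw [add_sub_cancel_right]
      rw [abs_le] at h ih ⊢
      constructor <;> linarith [h.1, h.2, ih.1, ih.2]
  refine key.trans (mul_le_mul_of_nonneg_left ?_ (emConst_nonneg _ _ _))
  have : (0 : ℝ) ≤ M - 1 := by
    have : (2 : ℝ) ≤ M := by exact_mod_cast hN.trans hM
    linarith
  have : 0 ≤ 1 / ((M : ℝ) - 1) ^ (r + 2 * k - 1) := by positivity
  linarith

theorem tendsto_logPoly_succ (r : ℕ) (t : ℚ × ℚ × ℚ) :
    Filter.Tendsto (logPoly (r + 1) t) Filter.atTop (nhds 0) := by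
  have h (j : ℕ) : Filter.Tendsto (fun x : ℝ ↦ log x ^ j / x ^ (r + 1)) Filter.atTop (nhds 0) := by
    have h0 := (isLittleO_pow_log_id_atTop (n := j)).tendsto_div_nhds_zero
    refine squeeze_zero_norm' ?_ (by simpa using h0.norm)
    filter_upwards [Filter.eventually_ge_atTop 1] with x hx
    have hx0 : 0 < x := by linarith
    rw [norm_div, norm_pow, norm_pow, Real.norm_eq_abs, Real.norm_of_nonneg hx0.le,
      abs_of_pos hx0]
    refine div_le_div_of_nonneg_left (by positivity) hx0 ?_
    simpa using pow_le_pow_right₀ hx (by omega : 1 ≤ r + 1)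
  have h2 := (((h 0).const_mul (t.1 : ℝ)).add ((h 1).const_mul (t.2.1 : ℝ))).add
    ((h 2).const_mul (t.2.2 : ℝ))
  simp only [mul_zero, add_zero] at h2
  refine h2.congr fun x ↦ ?_
  rw [logPoly]
  ring

theorem tendsto_emPrimitive_succ (r : ℕ) (t : ℚ × ℚ × ℚ) (K : ℕ) :
    Filter.Tendsto (emPrimitive (r + 1) t K) Filter.atTop (nhds 0) := by
  have : emPrimitive (r + 1) t K = fun x ↦ ∑ k ∈ Finset.range (K + 1),
    (bernoulli k / k.factorial : ℝ) * logPoly (r + k + 1) (logPolyIter (r + 1) t k) x := by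
    ext x
    refine Finset.sum_congr rfl fun k _ ↦ ?_
    rw [Nat.add_right_comm]
  rw [this]
  simpa using tendsto_finsetSum _ fun k _ ↦
    ((tendsto_logPoly_succ (r + k) (logPolyIter (r + 1) t k)).const_mul
      (bernoulli k / k.factorial : ℝ))

theorem abs_tsum_sub_le {r : ℕ} {t : ℚ × ℚ × ℚ} {k : ℕ} (hk : k ≠ 0) {N : ℕ} (hN : 2 ≤ N)
    {f : ℕ → ℝ} (hf : Summable f)
    (hfe : ∀ n, 2 ≤ n → f n = logPoly (r + 2) (logPolyIter (r + 1) t 1) n) :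
    |∑' n, f n - (∑ n ∈ Finset.range N, f n - emPrimitive (r + 1) t (2 * k) N)| ≤
      emConst (r + 1) t (2 * k) * (1 / ((N : ℝ) - 1) ^ (r + 2 * k)) := by
  have hlim : Filter.Tendsto (fun M : ℕ ↦ |∑ n ∈ Finset.range M, f n - ∑ n ∈ Finset.range N, f n -
      (emPrimitive (r + 1) t (2 * k) M - emPrimitive (r + 1) t (2 * k) N)|) Filter.atTop
      (nhds |∑' n, f n - ∑ n ∈ Finset.range N, f n -
        (0 - emPrimitive (r + 1) t (2 * k) N)|) :=
    ((hf.hasSum.tendsto_sum_nat.sub_const _).sub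
      (((tendsto_emPrimitive_succ r t (2 * k)).comp tendsto_natCast_atTop_atTop).sub_const _)).abs
  rw [show ∑' n, f n - (∑ n ∈ Finset.range N, f n - emPrimitive (r + 1) t (2 * k) N) =
    ∑' n, f n - ∑ n ∈ Finset.range N, f n - (0 - emPrimitive (r + 1) t (2 * k) N) by ring]
  refine le_of_tendsto hlim ?_
  filter_upwards [Filter.eventually_ge_atTop N] with M hM
  have h := abs_sum_sub_emPrimitive_le (r + 1) t hk hN hM
  rw [show r + 1 + 2 * k - 1 = r + 2 * k by omega] at h
  rw [← Finset.sum_Ico_eq_sub _ hM]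
  rw [Finset.sum_congr rfl fun n hn ↦ hfe n (hN.trans (Finset.mem_Ico.mp hn).1)]
  exact h

theorem abs_eulerMascheroniConstant_sub_le {k : ℕ} (hk : k ≠ 0) {N : ℕ} (hN : 2 ≤ N) :
    |eulerMascheroniConstant - (∑ n ∈ Finset.range N, 1 / (n : ℝ) -
        emPrimitive 0 (0, 1, 0) (2 * k) N)| ≤
      emConst 0 (0, 1, 0) (2 * k) * (1 / ((N : ℝ) - 1) ^ (2 * k - 1)) := by
  have hsum (M : ℕ) : (harmonic M : ℝ) = ∑ n ∈ Finset.range M, 1 / (n : ℝ) + 1 / M := by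
    rw [← Finset.sum_range_succ, Finset.sum_range_succ', harmonic]
    simp
  have hprim : emPrimitive 0 (0, 1, 0) (2 * k) = fun x ↦ ∑ j ∈ Finset.range (2 * k),
      (bernoulli (j + 1) / (j + 1).factorial : ℝ) *
        logPoly (j + 1) (logPolyIter 0 (0, 1, 0) (j + 1)) x + log x := by
    ext x
    rw [emPrimitive, Finset.sum_range_succ']
    simp [logPoly, logPolyIter]
  have h0 : Filter.Tendsto (fun x : ℝ ↦ ∑ j ∈ Finset.range (2 * k),
      (bernoulli (j + 1) / (j + 1).factorial : ℝ) *
        logPoly (j + 1) (logPolyIter 0 (0, 1, 0) (j + 1)) x) Filter.atTop (nhds 0) := by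
    simpa using tendsto_finsetSum _ fun j _ ↦
      ((tendsto_logPoly_succ j (logPolyIter 0 (0, 1, 0) (j + 1))).const_mul
        (bernoulli (j + 1) / (j + 1).factorial : ℝ))
  have hlim0 := ((tendsto_harmonic_sub_log.sub tendsto_one_div_atTop_nhds_zero_nat).sub
    (h0.comp tendsto_natCast_atTop_atTop))
  have hlim := ((hlim0.sub_const (∑ n ∈ Finset.range N, 1 / (n : ℝ))).add_const
    (emPrimitive 0 (0, 1, 0) (2 * k) N)).abs
  rw [show eulerMascheroniConstant - (∑ n ∈ Finset.range N, 1 / (n : ℝ) -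
        emPrimitive 0 (0, 1, 0) (2 * k) N) = eulerMascheroniConstant - 0 - 0 -
        ∑ n ∈ Finset.range N, 1 / (n : ℝ) + emPrimitive 0 (0, 1, 0) (2 * k) N by ring]
  refine le_of_tendsto hlim ?_
  filter_upwards [Filter.eventually_ge_atTop N] with M hM
  have h := abs_sum_sub_emPrimitive_le 0 (0, 1, 0) hk hN hM
  rw [zero_add (2 * k)] at h
  convert! h using 2
  rw [Finset.sum_Ico_eq_sub _ hM]
  have he (n : ℕ) : logPoly (0 + 1) (logPolyIter 0 (0, 1, 0) 1) n = 1 / (n : ℝ) := by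
    simp [logPoly, logPolyIter, logPolyDeriv]
  simp only [he, hsum, Function.comp_apply, hprim]
  ring

theorem LSeries_term_ofReal (f : ℕ → ℝ) {s : ℕ} (hs : s ≠ 0) (n : ℕ) :
    LSeries.term (fun n ↦ (f n : ℂ)) s n = ((f n / (n : ℝ) ^ s : ℝ) : ℂ) := by
  rw [LSeries.term_of_ne_zero' (by exact_mod_cast hs)]
  push_cast
  rw [Complex.cpow_natCast]

theorem LSeriesSummable_ofReal_iff (f : ℕ → ℝ) {s : ℕ} (hs : s ≠ 0) :
    LSeriesSummable (fun n ↦ (f n : ℂ)) s ↔ Summable fun n : ℕ ↦ f n / (n : ℝ) ^ s := by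
  rw [LSeriesSummable, ← Complex.summable_ofReal]
  exact summable_congr fun n ↦ LSeries_term_ofReal f hs n

theorem LSeries_ofReal (f : ℕ → ℝ) {s : ℕ} (hs : s ≠ 0) :
    LSeries (fun n ↦ (f n : ℂ)) s = ((∑' n : ℕ, f n / (n : ℝ) ^ s : ℝ) : ℂ) := by
  rw [LSeries, Complex.ofReal_tsum]
  exact tsum_congr fun n ↦ LSeries_term_ofReal f hs n

open ArithmeticFunction hiding log in
theorem abscissaOfAbsConv_vonMangoldt_le :
    LSeries.abscissaOfAbsConv (fun n ↦ (vonMangoldt n : ℂ)) ≤ 1 := by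
  refine LSeries.abscissaOfAbsConv_le_of_forall_lt_LSeriesSummable' fun y hy ↦ ?_
  exact LSeriesSummable_vonMangoldt (by simpa using (by exact_mod_cast hy : 1 < y))

open ArithmeticFunction hiding log in
theorem LSeries_logMul_vonMangoldt {s : ℂ} (hs : 1 < s.re) :
    LSeries (LSeries.logMul fun n ↦ (vonMangoldt n : ℂ)) s * LSeries 1 s +
      LSeries (fun n ↦ (vonMangoldt n : ℂ)) s * LSeries (LSeries.logMul 1) s =
      LSeries (LSeries.logMul (LSeries.logMul 1)) s := by
  have hs' : (1 : EReal) < s.re := by exact_mod_cast hs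
  have hΛ := LSeries_hasDerivAt (abscissaOfAbsConv_vonMangoldt_le.trans_lt hs')
  have h1 := LSeries_hasDerivAt (f := 1) (s := s) (by rwa [LSeries.abscissaOfAbsConv_one])
  have hl := LSeries_hasDerivAt (f := LSeries.logMul 1) (s := s)
    (by rwa [LSeries.abscissaOfAbsConv_logMul, LSeries.abscissaOfAbsConv_one])
  have heq : (LSeries fun n ↦ (vonMangoldt n : ℂ)) * LSeries 1 =ᶠ[nhds s]
      LSeries (LSeries.logMul 1) := by
    filter_upwards [(isOpen_lt continuous_const Complex.continuous_re).mem_nhds hs] with z hz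
    rw [Pi.mul_apply, ← LSeries_convolution' (LSeriesSummable_vonMangoldt hz)
      (LSeriesSummable_one_iff.mpr hz), convolution_vonMangoldt_const_one]
    exact LSeries_congr (fun _ ↦ by simp [LSeries.logMul]) z
  have := ((hΛ.mul h1).congr_of_eventuallyEq heq.symm).unique hl
  linear_combination -this

theorem summable_log_pow_div_nat_pow (j : ℕ) {s : ℕ} (hs : 2 ≤ s) :
    Summable fun n : ℕ ↦ log n ^ j / (n : ℝ) ^ s := by
  have hs' : (1 : EReal) < ((s : ℂ).re) := by
    rw [Complex.natCast_re]
    exact_mod_cast hs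
  have h := LSeriesSummable_of_abscissaOfAbsConv_lt_re (f := LSeries.logMul^[j] 1) (s := s)
    (by rwa [LSeries.absicssaOfAbsConv_logPowMul, LSeries.abscissaOfAbsConv_one])
  rw [← LSeriesSummable_ofReal_iff _ (by omega)]
  refine (LSeriesSummable_congr _ fun {n} _ ↦ ?_).mp h
  clear h
  induction j with
  | zero => simp
  | succ j ih => rw [Function.iterate_succ_apply', LSeries.logMul, ih]; simp [pow_succ']

/-- The series of `log^j n / n^s`. -/
noncomputable def logZeta (j s : ℕ) : ℝ := ∑' n : ℕ, log n ^ j / (n : ℝ) ^ s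

theorem logZeta_zero_pos {s : ℕ} (hs : 2 ≤ s) : 1 ≤ logZeta 0 s := by
  have h := summable_log_pow_div_nat_pow 0 hs
  simpa [logZeta] using h.le_tsum 1 (fun n _ ↦ by positivity)

/-- The term of the logarithmic derivative series of the Euler product at `p`. -/
noncomputable def primeTerm (s p : ℕ) : ℝ :=
  log p ^ 2 * (((p : ℝ) ^ s)⁻¹ / (1 - ((p : ℝ) ^ s)⁻¹) ^ 2)

open ArithmeticFunction hiding log in
theorem hasSum_primeTerm {s : ℕ} (hs : 2 ≤ s) :
    HasSum (fun p : Nat.Primes ↦ primeTerm s p)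
      (logZeta 2 s / logZeta 0 s - (logZeta 1 s / logZeta 0 s) ^ 2) := by
  have hs0 : s ≠ 0 := by omega
  have hre : 1 < (s : ℂ).re := by
    rw [Complex.natCast_re]
    exact_mod_cast hs
  have hs' : (1 : EReal) < ((s : ℂ).re) := by exact_mod_cast hre
  have hlm (f : ℕ → ℝ) : LSeries.logMul (fun n ↦ (f n : ℂ)) =
      fun n : ℕ ↦ ((log n * f n : ℝ) : ℂ) := by
    ext n
    simp [LSeries.logMul]
  have h1 : (1 : ℕ → ℂ) = fun n ↦ (((fun _ ↦ 1 : ℕ → ℝ) n : ℝ) : ℂ) := by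
    ext n
    simp
  have hz1 : LSeries.logMul (1 : ℕ → ℂ) = fun n : ℕ ↦ ((log n ^ 1 : ℝ) : ℂ) := by
    rw [h1, hlm]
    simp
  have hz2 : LSeries.logMul (LSeries.logMul (1 : ℕ → ℂ)) = fun n : ℕ ↦ ((log n ^ 2 : ℝ) : ℂ) := by
    rw [hz1, hlm]
    simp [sq]
  have hz0 : (1 : ℕ → ℂ) = fun n : ℕ ↦ ((log n ^ 0 : ℝ) : ℂ) := by
    ext n
    simp
  have hsum : Summable fun n : ℕ ↦ log n * vonMangoldt n / (n : ℝ) ^ s := by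
    rw [← LSeriesSummable_ofReal_iff _ hs0, ← hlm]
    exact LSeriesSummable_logMul_of_lt_re (abscissaOfAbsConv_vonMangoldt_le.trans_lt hs')
  have hA := LSeries_logMul_vonMangoldt hre
  have hB : LSeries (fun n ↦ (vonMangoldt n : ℂ)) s * LSeries 1 s =
      LSeries (LSeries.logMul 1) s := by
    rw [← LSeries_convolution' (LSeriesSummable_vonMangoldt hre)
      (LSeriesSummable_one_iff.mpr hre), convolution_vonMangoldt_const_one]
    exact LSeries_congr (fun _ ↦ by simp [LSeries.logMul]) _
  rw [hz2, hz1, hlm, hz0, LSeries_ofReal _ hs0, LSeries_ofReal _ hs0, LSeries_ofReal _ hs0,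
    LSeries_ofReal _ hs0, LSeries_ofReal _ hs0] at hA
  rw [hz1, hz0, LSeries_ofReal _ hs0, LSeries_ofReal _ hs0, LSeries_ofReal _ hs0] at hB
  rw [← Complex.ofReal_mul, ← Complex.ofReal_mul, ← Complex.ofReal_add, Complex.ofReal_inj] at hA
  rw [← Complex.ofReal_mul, Complex.ofReal_inj] at hB
  change _ * logZeta 0 s + _ * logZeta 1 s = logZeta 2 s at hA
  change _ * logZeta 0 s = logZeta 1 s at hB
  have hpos := logZeta_zero_pos hs
  have hval : ∑' n : ℕ, log n * vonMangoldt n / (n : ℝ) ^ s =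
      logZeta 2 s / logZeta 0 s - (logZeta 1 s / logZeta 0 s) ^ 2 := by
    rw [← hA, ← hB]
    field_simp
    ring
  rw [← hval]
  have hsupp : Function.support (fun n : ℕ ↦ log n * vonMangoldt n / (n : ℝ) ^ s) ⊆
      {n | IsPrimePow n} := by
    intro n hn
    by_contra h
    exact hn (by simp [vonMangoldt_eq_zero_iff.mpr h])
  have hp : ∀ p : Nat.Primes, HasSum (fun k : ℕ ↦ log ((p : ℕ) ^ (k + 1) : ℕ) *
      vonMangoldt ((p : ℕ) ^ (k + 1)) / (((p : ℕ) ^ (k + 1) : ℕ) : ℝ) ^ s) (primeTerm s p) := by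
    intro p
    have hp1 : (1 : ℝ) < (p : ℕ) := by exact_mod_cast p.2.one_lt
    have hlt : ‖(((p : ℕ) : ℝ) ^ s)⁻¹‖ < 1 := by
      rw [norm_inv, norm_pow, Real.norm_of_nonneg (by positivity)]
      exact inv_lt_one_of_one_lt₀ (one_lt_pow₀ hp1 hs0)
    have hg := (hasSum_coe_mul_geometric_of_norm_lt_one hlt)
    rw [← hasSum_nat_add_iff' 1] at hg
    simp only [Finset.sum_range_one, CharP.cast_eq_zero, zero_mul, sub_zero] at hg
    refine (hg.mul_left (log (p : ℕ) ^ 2)).congr_fun fun k ↦ ?_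
    rw [vonMangoldt_apply_pow (by omega), vonMangoldt_apply_prime p.2]
    push_cast
    rw [Real.log_pow, ← inv_pow, pow_right_comm, inv_pow]
    push_cast
    ring
  rw [tsum_eq_tsum_primes_of_support_subset_prime_powers hsum hsupp]
  simp_rw [(hp _).tsum_eq]
  refine Summable.hasSum ?_
  have hs2 : Summable fun q : Nat.Primes × ℕ ↦ log ((q.1 : ℕ) ^ (q.2 + 1) : ℕ) *
      vonMangoldt ((q.1 : ℕ) ^ (q.2 + 1)) / (((q.1 : ℕ) ^ (q.2 + 1) : ℕ) : ℝ) ^ s := by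
    have := hsum.comp_injective
      (Subtype.val_injective.comp Nat.Primes.prodNatEquiv.injective)
    exact this
  exact (hs2.prod).congr fun p ↦ (hp p).tsum_eq

/-- The Bernoulli numbers of index at most `20`. -/
def bernoulliTable : ℕ → ℚ
  | 0 => 1
  | 1 => -1 / 2
  | 2 => 1 / 6
  | 4 => -1 / 30
  | 6 => 1 / 42
  | 8 => -1 / 30
  | 10 => 5 / 66
  | 12 => -691 / 2730
  | 14 => 7 / 6
  | 16 => -3617 / 510
  | 18 => 43867 / 798
  | 20 => -174611 / 330
  | _ => 0

theorem bernoulli_eq_bernoulliTable {n : ℕ} (hn : n ≤ 20) : bernoulli n = bernoulliTable n := by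
  have hT : ∀ m < 21, ∑ k ∈ Finset.range (m + 1), ((m + 1).choose k : ℚ) * bernoulliTable k =
      if m + 1 = 1 then 1 else 0 := by
    decide +kernel
  induction n using Nat.strong_induction_on with
  | _ n ih =>
    have h1 := sum_bernoulli (n + 1)
    have h2 := hT n (by omega)
    rw [Finset.sum_range_succ] at h1 h2
    rw [Finset.sum_congr rfl fun k hk ↦ by
      rw [ih k (Finset.mem_range.mp hk) ((Finset.mem_range.mp hk).le.trans hn)]] at h1
    have h3 : ((n + 1).choose n : ℚ) ≠ 0 := by
      rw [Nat.choose_succ_self_right]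
      positivity
    exact mul_left_cancel₀ h3 (by linarith)

/-- Decimal approximations of the logarithms of the natural numbers below `64`. -/
def logTable (n : ℕ) : ℚ :=
  (([
    0, 0,
    69314718055994530941723212145818, 109861228866810969139524523692253,
    138629436111989061883446424291635, 160943791243410037460075933322619,
    179175946922805500081247735838070, 194591014905531330510535274344318,
    207944154167983592825169636437453, 219722457733621938279049047384505,
    230258509299404568401799145468436, 239789527279837054406194357796513,
    248490664978800031022970947983888, 256494935746153673605348744156532,
    263905732961525861452258486490136, 270805020110221006599600457014871,
    277258872223978123766892848583271, 283321334405621608024953461787313,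
    289037175789616469220772259530323, 294443897916644046000902743188785,
    299573227355399099343522357614254, 304452243772342299650059798036571,
    309104245335831585347917569942331, 313549421592914969080675283181020,
    317805383034794561964694160129706, 321887582486820074920151866645238,
    325809653802148204547071956302350, 329583686600432907418573571076758,
    333220451017520392393981698635953, 336729582998647402718327203236191,
    340119738166215537541323669160689, 343398720448514624592916432454236,
    346573590279972654708616060729088, 349650756146648023545718881488766,
    352636052461616138966676673933130, 355534806148941367970611207666937,
    358351893845611000162495471676140, 361091791264422444436809567103145,
    363758615972638576942625955334603, 366356164612964642744873267848784,
    368887945411393630285245569760072, 371357206670430780386676337303741,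
    373766961828336830591783010182388, 376120011569356242347284251334585,
    378418963391826116289640782088148, 380666248977031975739124980707124,
    382864139648909500022398495326837, 385014760171005858682095066977217,
    387120101090789092906417372275523, 389182029811062661021070548688636,
    391202300542814605861875078791055, 393182563272432577164477985479565,
    395124371858142735488795168448167, 397029191355212183414446913902906,
    398898404656427438360296783222575, 400733318523247091866270291119132,
    402535169073514923335704910781771, 404305126783455015140427266881038,
    406044301054641933660050415382009, 407753744390571945061605037371970,
    409434456222210068483046881306507, 411087386417331124875138910342561,
    412713438504509155534639644600053, 414313472639153268789584321728823] :
    List ℕ).getD n 0 : ℚ) / 10 ^ 32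

theorem abs_log_succ_sub_log_sub_le {m : ℕ} (hm : m ≠ 0) (n : ℕ) :
    |log (m + 1) - log m -
        2 * ∑ i ∈ Finset.range n, (1 / (2 * m + 1 : ℝ)) ^ (2 * i + 1) / (2 * i + 1)| ≤
      2 * ((1 / (2 * m + 1 : ℝ)) ^ (2 * n + 1) / (1 - (1 / (2 * m + 1 : ℝ)) ^ 2)) := by
  have hm0 : (0 : ℝ) < m := by positivity
  have hx0 : (0 : ℝ) ≤ 1 / (2 * m + 1) := by positivity
  have hx1 : 1 / (2 * m + 1) < (1 : ℝ) := by
    rw [div_lt_one (by positivity)]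
    linarith
  have h1 := sum_range_le_log_div hx0 hx1 n
  have h2 := log_div_le_sum_range_add hx0 hx1 n
  have he : (1 + 1 / (2 * m + 1)) / (1 - 1 / (2 * m + 1)) = ((m : ℝ) + 1) / m := by
    rw [div_eq_div_iff (by linarith) hm0.ne']
    field_simp
    ring
  rw [he, log_div (by positivity) hm0.ne'] at h1 h2
  rw [abs_le]
  constructor <;> linarith

theorem abs_log_sub_logTable_le {n : ℕ} (hn : n < 64) :
    |log n - logTable n| ≤ ((1 / 10 ^ 28 : ℚ) : ℝ) := by
  have hT : ∀ m < 63, m ≠ 0 → |logTable (m + 1) - logTable m -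
      2 * ∑ i ∈ Finset.range 32, (1 / (2 * m + 1 : ℚ)) ^ (2 * i + 1) / (2 * i + 1)| +
      2 * ((1 / (2 * m + 1 : ℚ)) ^ (2 * 32 + 1) / (1 - (1 / (2 * m + 1 : ℚ)) ^ 2)) ≤
      1 / 10 ^ 30 := by
    decide +kernel
  have key : ∀ m, m < 63 → |log (m + 1 : ℕ) - logTable (m + 1)| ≤ (m : ℝ) * (1 / 10 ^ 30) := by
    intro m
    induction m with
    | zero =>
      intro _
      simp [show logTable 1 = 0 by decide +kernel]
    | succ m ih =>
      intro hm
      have h1 := ih (by omega)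
      have h2 := abs_log_succ_sub_log_sub_le (m := m + 1) (by omega) 32
      have h3 := (Rat.cast_le (K := ℝ)).mpr (hT (m + 1) (by omega) (by omega))
      rw [Rat.cast_add, Rat.cast_abs, Rat.cast_sub, Rat.cast_sub] at h3
      push_cast at h1 h2 h3 ⊢
      rw [abs_le] at h1 h2 ⊢
      have h4 := le_abs_self ((logTable (m + 1 + 1) : ℝ) - logTable (m + 1) -
        2 * ∑ i ∈ Finset.range 32, (1 / (2 * (m + 1 : ℝ) + 1)) ^ (2 * i + 1) / (2 * i + 1))
      have h5 := neg_le_abs ((logTable (m + 1 + 1) : ℝ) - logTable (m + 1) -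
        2 * ∑ i ∈ Finset.range 32, (1 / (2 * (m + 1 : ℝ) + 1)) ^ (2 * i + 1) / (2 * i + 1))
      constructor <;> linarith [h1.1, h1.2, h2.1, h2.2]
  rcases n with _ | n
  · simp [show logTable 0 = 0 by decide +kernel]
  · refine (key n (by omega)).trans ?_
    have : (n : ℝ) ≤ 63 := by exact_mod_cast (by omega : n ≤ 63)
    push_cast
    linarith

theorem abs_log_pow_sub_logTable_pow_le {n : ℕ} (hn : n < 64) {j : ℕ} (hj : j ≤ 2) :
    |log n ^ j - (logTable n : ℝ) ^ j| ≤ 9 / 10 ^ 28 := by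
  have h := abs_log_sub_logTable_le hn
  have hT : ∀ m < 64, 0 ≤ logTable m ∧ logTable m ≤ 21 / 5 := by decide +kernel
  obtain ⟨h0, h1⟩ := hT n hn
  have h0' : (0 : ℝ) ≤ logTable n := by exact_mod_cast h0
  have h1' := (Rat.cast_le (K := ℝ)).mpr h1
  push_cast at h1'
  push_cast at h
  interval_cases j
  · norm_num
  · rw [pow_one, pow_one]
    linarith
  · rw [sq_sub_sq, abs_mul]
    have h2 : |log n + logTable n| ≤ 9 := by
      rw [abs_le] at h ⊢
      constructor <;> linarith [h.1, h.2]
    calc _ ≤ 9 * (1 / 10 ^ 28 : ℝ) := mul_le_mul h2 h (abs_nonneg _) (by norm_num)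
      _ = _ := by norm_num

/-- A rational approximation of `emPrimitive r t 20 32`. -/
def emPrimitiveApprox (r : ℕ) (t : ℚ × ℚ × ℚ) : ℚ :=
  ∑ k ∈ Finset.range 21, bernoulliTable k / k.factorial *
    (((logPolyIter r t k).1 + (logPolyIter r t k).2.1 * logTable 32 +
      (logPolyIter r t k).2.2 * logTable 32 ^ 2) / 32 ^ (r + k))

/-- A bound for the error of `emPrimitiveApprox`. -/
def emPrimitiveError (r : ℕ) (t : ℚ × ℚ × ℚ) : ℚ :=
  ∑ k ∈ Finset.range 21, |bernoulliTable k / k.factorial| *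
    ((|(logPolyIter r t k).2.1| + |(logPolyIter r t k).2.2|) * (9 / 10 ^ 28) / 32 ^ (r + k))

theorem abs_emPrimitive_sub_le (r : ℕ) (t : ℚ × ℚ × ℚ) :
    |emPrimitive r t 20 (32 : ℕ) - emPrimitiveApprox r t| ≤ emPrimitiveError r t := by
  rw [emPrimitive, emPrimitiveApprox, emPrimitiveError]
  push_cast
  rw [← Finset.sum_sub_distrib]
  refine (Finset.abs_sum_le_sum_abs _ _).trans (Finset.sum_le_sum fun k hk ↦ ?_)
  rw [bernoulli_eq_bernoulliTable (by have := Finset.mem_range.mp hk; omega), ← mul_sub, abs_mul]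
  refine mul_le_mul_of_nonneg_left ?_ (abs_nonneg _)
  have h1 := abs_log_pow_sub_logTable_pow_le (n := 32) (by norm_num) (j := 1) (by norm_num)
  have h2 := abs_log_pow_sub_logTable_pow_le (n := 32) (by norm_num) (j := 2) (by norm_num)
  rw [pow_one, pow_one] at h1
  push_cast at h1 h2
  rw [logPoly, ← sub_div, abs_div, abs_of_pos (by positivity : (0 : ℝ) < 32 ^ (r + k))]
  refine div_le_div_of_nonneg_right ?_ (by positivity)
  set u := logPolyIter r t k
  calc _ = |(u.2.1 : ℝ) * (log 32 - logTable 32) + u.2.2 * (log 32 ^ 2 - logTable 32 ^ 2)| := by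
        congr 1
        ring
    _ ≤ |(u.2.1 : ℝ)| * (9 / 10 ^ 28) + |(u.2.2 : ℝ)| * (9 / 10 ^ 28) := by
        refine (abs_add_le _ _).trans ?_
        rw [abs_mul, abs_mul]
        gcongr
    _ = _ := by ring

/-- The error constant `emConst` as a rational number. -/
def emConstRat (r : ℕ) (t : ℚ × ℚ × ℚ) : ℚ :=
  |bernoulliTable 20| / Nat.factorial 20 * tripleNorm (logPolyIter r t 21) / (r + 20 - 1 : ℕ)

theorem emConst_eq (r : ℕ) (t : ℚ × ℚ × ℚ) : emConst r t 20 = emConstRat r t := by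
  rw [emConst, emConstRat, bernoulli_eq_bernoulliTable le_rfl]
  push_cast
  rfl

/-- The coefficients of the antiderivative of `log^j x / x ^ (r + 1)`, written over `x ^ r`. -/
def logZetaCoeff (j r : ℕ) : ℚ × ℚ × ℚ :=
  match j with
  | 0 => (-1 / r, 0, 0)
  | 1 => (-1 / r ^ 2, -1 / r, 0)
  | _ => (-2 / r ^ 3, -2 / r ^ 2, -1 / r)

theorem logPoly_logZetaCoeff {j : ℕ} (hj : j ≤ 2) (r : ℕ) (x : ℝ) :
    logPoly (r + 2) (logPolyIter (r + 1) (logZetaCoeff j (r + 1)) 1) x =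
      log x ^ j / x ^ (r + 2) := by
  have hr : (r : ℝ) + 1 ≠ 0 := by positivity
  interval_cases j <;> simp only [logPoly, logPolyIter, logPolyDeriv, logZetaCoeff] <;>
    push_cast <;> congr 1 <;> field_simp <;> ring

/-- A rational approximation of `logZeta j (r + 2)`. -/
def logZetaApprox (j r : ℕ) : ℚ :=
  ∑ n ∈ Finset.range 32, logTable n ^ j / n ^ (r + 2) -
    emPrimitiveApprox (r + 1) (logZetaCoeff j (r + 1))

/-- A bound for the error of `logZetaApprox`. -/
def logZetaError (j r : ℕ) : ℚ :=
  ∑ n ∈ Finset.range 32, (9 / 10 ^ 28) / (n : ℚ) ^ (r + 2) +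
    emPrimitiveError (r + 1) (logZetaCoeff j (r + 1)) +
    emConstRat (r + 1) (logZetaCoeff j (r + 1)) * (1 / 31 ^ (r + 20))

theorem abs_logZeta_sub_le {j : ℕ} (hj : j ≤ 2) (r : ℕ) :
    |logZeta j (r + 2) - logZetaApprox j r| ≤ logZetaError j r := by
  have h1 := abs_tsum_sub_le (r := r) (t := logZetaCoeff j (r + 1)) (k := 10) (by norm_num)
    (N := 32) (by norm_num) (summable_log_pow_div_nat_pow j (s := r + 2) (by omega))
    (fun n _ ↦ (logPoly_logZetaCoeff hj r n).symm)
  have h2 := abs_emPrimitive_sub_le (r + 1) (logZetaCoeff j (r + 1))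
  have h3 : |∑ n ∈ Finset.range 32, log n ^ j / (n : ℝ) ^ (r + 2) -
      ∑ n ∈ Finset.range 32, (logTable n : ℝ) ^ j / (n : ℝ) ^ (r + 2)| ≤
      ∑ n ∈ Finset.range 32, (9 / 10 ^ 28) / (n : ℝ) ^ (r + 2) := by
    rw [← Finset.sum_sub_distrib]
    refine (Finset.abs_sum_le_sum_abs _ _).trans (Finset.sum_le_sum fun n hn ↦ ?_)
    rw [← sub_div, abs_div, abs_of_nonneg (by positivity : (0 : ℝ) ≤ (n : ℝ) ^ (r + 2))]
    refine div_le_div_of_nonneg_right (abs_log_pow_sub_logTable_pow_le ?_ hj) (by positivity)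
    have := Finset.mem_range.mp hn
    omega
  rw [show 2 * 10 = 20 from rfl, emConst_eq, show ((32 : ℕ) : ℝ) - 1 = 31 by norm_num] at h1
  rw [logZetaApprox, logZetaError]
  push_cast at h1 h2 h3 ⊢
  rw [← logZeta] at h1
  rw [abs_le] at h1 h2 h3 ⊢
  constructor <;> linarith [h1.1, h1.2, h2.1, h2.2, h3.1, h3.2]

theorem abs_div_sub_div_le {a b z q ε : ℝ} (hz : 1 ≤ z) (hq : 1 ≤ q) (hb : 0 ≤ b)
    (ha : |a - b| ≤ ε) (hzq : |z - q| ≤ ε) : |a / z - b / q| ≤ (1 + b) * ε := by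
  have hz0 : 0 < z := by linarith
  have hq0 : 0 < q := by linarith
  have hε : 0 ≤ ε := (abs_nonneg _).trans ha
  have h : a / z - b / q = (a - b) / z - b * ((z - q) / (z * q)) := by
    field_simp
    ring
  have h1 : |(a - b) / z| ≤ ε := by
    rw [abs_div, abs_of_pos hz0]
    exact (div_le_self (abs_nonneg _) hz).trans ha
  have h2 : |(z - q) / (z * q)| ≤ ε := by
    rw [abs_div, abs_of_pos (mul_pos hz0 hq0)]
    exact (div_le_self (abs_nonneg _) (one_le_mul_of_one_le_of_one_le hz hq)).trans hzq
  rw [h]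
  refine (abs_sub _ _).trans ?_
  rw [abs_mul, abs_of_nonneg hb]
  nlinarith

/-- A rational approximation of the sum of `primeTerm (r + 2)` over the primes. -/
def primeTermSumApprox (r : ℕ) : ℚ :=
  logZetaApprox 2 r / logZetaApprox 0 r - (logZetaApprox 1 r / logZetaApprox 0 r) ^ 2

theorem abs_logZeta_sub_primeTermSumApprox_le {r : ℕ}
    (hr : r ∈ ({0, 1, 2, 4, 7, 8, 10} : Finset ℕ)) :
    |logZeta 2 (r + 2) / logZeta 0 (r + 2) - (logZeta 1 (r + 2) / logZeta 0 (r + 2)) ^ 2 -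
      primeTermSumApprox r| ≤ 1 / 10 ^ 24 := by
  have hT : ∀ r ∈ ({0, 1, 2, 4, 7, 8, 10} : Finset ℕ), ∀ j < 3,
      logZetaError j r ≤ 1 / 10 ^ 25 := by
    decide +kernel
  have hB : ∀ r ∈ ({0, 1, 2, 4, 7, 8, 10} : Finset ℕ), 1 ≤ logZetaApprox 0 r ∧
      0 ≤ logZetaApprox 1 r ∧ logZetaApprox 1 r ≤ 1 ∧ 0 ≤ logZetaApprox 2 r ∧
      logZetaApprox 2 r ≤ 2 := by
    decide +kernel
  have hZ : ∀ j < 3, |logZeta j (r + 2) - logZetaApprox j r| ≤ 1 / 10 ^ 25 := by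
    intro j hj
    have h := (Rat.cast_le (K := ℝ)).mpr (hT r hr j hj)
    push_cast at h
    exact (abs_logZeta_sub_le (by omega) r).trans h
  obtain ⟨h0, h1, h1', h2, h2'⟩ := hB r hr
  have h0 : (1 : ℝ) ≤ logZetaApprox 0 r := by exact_mod_cast h0
  have h1 : (0 : ℝ) ≤ logZetaApprox 1 r := by exact_mod_cast h1
  have h1' : (logZetaApprox 1 r : ℝ) ≤ 1 := by exact_mod_cast h1'
  have h2 : (0 : ℝ) ≤ logZetaApprox 2 r := by exact_mod_cast h2
  have h2' : (logZetaApprox 2 r : ℝ) ≤ 2 := by exact_mod_cast h2'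
  have hz := logZeta_zero_pos (s := r + 2) (by omega)
  have h3 := abs_div_sub_div_le hz h0 h2 (hZ 2 (by norm_num)) (hZ 0 (by norm_num))
  have h4 := abs_div_sub_div_le hz h0 h1 (hZ 1 (by norm_num)) (hZ 0 (by norm_num))
  have h5 : (logZetaApprox 1 r / logZetaApprox 0 r : ℝ) ≤ 1 := (div_le_self h1 h0).trans h1'
  have h6 : 0 ≤ (logZetaApprox 1 r / logZetaApprox 0 r : ℝ) := by positivity
  rw [primeTermSumApprox]
  push_cast
  set x := logZeta 1 (r + 2) / logZeta 0 (r + 2)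
  set y := (logZetaApprox 1 r / logZetaApprox 0 r : ℝ)
  have h7 : |x - y| ≤ 2 * (1 / 10 ^ 25) := h4.trans (by gcongr; linarith)
  have h8 : |x + y| ≤ 3 := by
    rw [abs_le] at h7 ⊢
    constructor <;> linarith [h7.1, h7.2]
  have h9 : |x ^ 2 - y ^ 2| ≤ 3 * (2 * (1 / 10 ^ 25)) := by
    rw [sq_sub_sq, abs_mul]
    exact mul_le_mul h8 h7 (abs_nonneg _) (by norm_num)
  have h10 := h3.trans (mul_le_mul_of_nonneg_right
    (by linarith : 1 + (logZetaApprox 2 r : ℝ) ≤ 3) (by norm_num))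
  rw [abs_le] at h9 h10 ⊢
  constructor <;> linarith [h9.1, h9.2, h10.1, h10.2]

/-- The function `y / (1 - y) ^ 2`, with Taylor series `∑ m y ^ m`. -/
def koebe {K : Type*} [Field K] (y : K) : K := y / (1 - y) ^ 2

theorem koebe_sub_sum_bounds {M : ℕ} {y : ℝ} (hy : 0 ≤ y) (hM : 2 * (M + 2) * y ≤ 1) :
    0 ≤ koebe y - ∑ m ∈ Finset.range (M + 1), m * y ^ m ∧
      koebe y - ∑ m ∈ Finset.range (M + 1), m * y ^ m ≤ (M + 2) * y ^ (M + 1) := by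
  have hM0 : (0 : ℝ) ≤ M := by positivity
  have hy1 : 0 < 1 - y := by nlinarith
  have key : ∀ n : ℕ, koebe y - ∑ m ∈ Finset.range (n + 1), m * y ^ m =
      y ^ (n + 1) * (((n + 1) - n * y) / (1 - y) ^ 2) := by
    intro n
    induction n with
    | zero => simp [koebe, div_eq_mul_inv]
    | succ n ih =>
      rw [Finset.sum_range_succ, ← sub_sub, ih]
      push_cast
      field_simp
      ring
  rw [key]
  constructor
  · have : 0 ≤ (M + 1) - M * y := by nlinarith
    positivity
  · rw [mul_comm]
    gcongr
    rw [div_le_iff₀ (by positivity)]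
    nlinarith [mul_nonneg hM0 (sq_nonneg y), sq_nonneg y]

/-- What remains of `2 x ^ 2 - x ^ 3` after subtracting the combination of the `koebe (x ^ s)`
that agrees with it up to order `13`. -/
def koebeResidual {K : Type*} [Field K] (x : K) : K :=
  2 * x ^ 2 - x ^ 3 - (2 * koebe (x ^ 2) - koebe (x ^ 3) - 4 * koebe (x ^ 4) - 4 * koebe (x ^ 6) +
    3 * koebe (x ^ 9) - 10 * koebe (x ^ 10) + 12 * koebe (x ^ 12))

theorem abs_koebeResidual_le {x : ℝ} (hx : 0 ≤ x) (hx' : x ≤ 1 / 64) :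
    |koebeResidual x| ≤ 17 * x ^ 14 := by
  have hpow (s : ℕ) (hs : 2 ≤ s) : x ^ s ≤ 1 / 4096 :=
    calc x ^ s ≤ x ^ 2 := pow_le_pow_of_le_one hx (by linarith) hs
      _ ≤ (1 / 64) ^ 2 := by gcongr
      _ = 1 / 4096 := by norm_num
  have h (M s : ℕ) (hM : M ≤ 6) (hs : 2 ≤ s) := koebe_sub_sum_bounds (M := M) (pow_nonneg hx s) (by
    have h1 : (M : ℝ) ≤ 6 := by exact_mod_cast hM
    nlinarith [hpow s hs, pow_nonneg hx s])
  have h2 := h 6 2 (by norm_num) (by norm_num)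
  have h3 := h 4 3 (by norm_num) (by norm_num)
  have h4 := h 3 4 (by norm_num) (by norm_num)
  have h6 := h 2 6 (by norm_num) (by norm_num)
  have h9 := h 1 9 (by norm_num) (by norm_num)
  have h10 := h 1 10 (by norm_num) (by norm_num)
  have h12 := h 1 12 (by norm_num) (by norm_num)
  have hd (k : ℕ) : x ^ (14 + k + 1) ≤ x ^ (14 + k) / 64 := by
    rw [pow_succ]
    nlinarith [pow_nonneg hx (14 + k)]
  have hn (k : ℕ) : 0 ≤ x ^ k := pow_nonneg hx k
  simp only [Finset.sum_range_succ, Finset.sum_range_zero, ← pow_mul] at h2 h3 h4 h6 h9 h10 h12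
  norm_num at h2 h3 h4 h6 h9 h10 h12
  have e0 := hd 0
  have e1 := hd 1
  have e2 := hd 2
  have e3 := hd 3
  have e4 := hd 4
  have e5 := hd 5
  have e6 := hd 6
  have e7 := hd 7
  have e8 := hd 8
  have e9 := hd 9
  norm_num at e0 e1 e2 e3 e4 e5 e6 e7 e8 e9
  rw [koebeResidual, abs_le]
  constructor <;> linarith [hn 14, hn 24]

theorem primeTerm_eq (s p : ℕ) : primeTerm s p = log p ^ 2 * koebe ((1 / (p : ℝ)) ^ s) := by
  rw [primeTerm, koebe, one_div, inv_pow]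

theorem summable_log_sq_div_prime_pow {s : ℕ} (hs : 2 ≤ s) :
    Summable fun p : Nat.Primes ↦ log ((p : ℕ) : ℝ) ^ 2 / ((p : ℕ) : ℝ) ^ s :=
  (summable_log_pow_div_nat_pow 2 hs).comp_injective Subtype.val_injective

theorem hasSum_koebeResidual :
    HasSum (fun p : Nat.Primes ↦ log ((p : ℕ) : ℝ) ^ 2 * koebeResidual (1 / ((p : ℕ) : ℝ)))
      (2 * (∑' p : Nat.Primes, log ((p : ℕ) : ℝ) ^ 2 / ((p : ℕ) : ℝ) ^ 2) -
        (∑' p : Nat.Primes, log ((p : ℕ) : ℝ) ^ 2 / ((p : ℕ) : ℝ) ^ 3) -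
        (2 * (∑' p : Nat.Primes, primeTerm 2 p) - (∑' p : Nat.Primes, primeTerm 3 p) -
          4 * (∑' p : Nat.Primes, primeTerm 4 p) - 4 * (∑' p : Nat.Primes, primeTerm 6 p) +
          3 * (∑' p : Nat.Primes, primeTerm 9 p) - 10 * (∑' p : Nat.Primes, primeTerm 10 p) +
          12 * (∑' p : Nat.Primes, primeTerm 12 p))) := by
  have h (s : ℕ) (hs : 2 ≤ s) := (hasSum_primeTerm hs).summable.hasSum
  have hc := (((((((h 2 le_rfl).mul_left 2).sub (h 3 (by norm_num))).sub
    ((h 4 (by norm_num)).mul_left 4)).sub ((h 6 (by norm_num)).mul_left 4)).add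
    ((h 9 (by norm_num)).mul_left 3)).sub ((h 10 (by norm_num)).mul_left 10)).add
    ((h 12 (by norm_num)).mul_left 12)
  refine ((((summable_log_sq_div_prime_pow le_rfl).hasSum.mul_left 2).sub
    (summable_log_sq_div_prime_pow (by norm_num)).hasSum).sub hc).congr_fun fun p ↦ ?_
  simp only [primeTerm_eq, koebeResidual]
  ring

theorem hasSum_ite_prime {f : ℕ → ℝ} {a : ℝ} (h : HasSum (fun p : Nat.Primes ↦ f p) a) :
    HasSum (fun n ↦ if n.Prime then f n else 0) a := by
  refine ((hasSum_subtype_iff_indicator (f := f) (s := {n | n.Prime})).mp h).congr_fun fun n ↦ ?_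
  simp [Set.indicator]

theorem tsum_one_div_pow_le {m N : ℕ} (hm : m ≠ 0) (hN : 2 ≤ N) :
    ∑' n : ℕ, 1 / ((n + N : ℕ) : ℝ) ^ (m + 1) ≤ 1 / m * (1 / ((N : ℝ) - 1) ^ m) := by
  have hN' : (2 : ℝ) ≤ N := by exact_mod_cast hN
  refine Real.tsum_le_of_sum_range_le (fun n ↦ by positivity) fun M ↦ ?_
  have key : ∑ n ∈ Finset.range M, 1 / ((n + N : ℕ) : ℝ) ^ (m + 1) ≤
      1 / m * (1 / ((N : ℝ) - 1) ^ m - 1 / (M + N - 1 : ℝ) ^ m) := by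
    induction M with
    | zero => simp
    | succ M ih =>
      have h := one_div_pow_succ_le m hm (x := M + N) (by linarith [(M.cast_nonneg : (0 : ℝ) ≤ M)])
      rw [Finset.sum_range_succ]
      push_cast at ih ⊢
      rw [show (M : ℝ) + 1 + N - 1 = M + N by ring]
      linarith
  refine key.trans ?_
  have : (0 : ℝ) ≤ M + N - 1 := by linarith [(M.cast_nonneg : (0 : ℝ) ≤ M)]
  gcongr
  rw [sub_le_self_iff]
  positivity

/-- A rational approximation of the sum of `log p ^ 2 * koebeResidual (1 / p)` over the primes. -/
def koebeResidualSumApprox : ℚ :=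
  ∑ n ∈ Finset.range 64, if n.Prime then logTable n ^ 2 * koebeResidual (1 / (n : ℚ)) else 0

theorem abs_sum_koebeResidual_sub_le {a : ℝ}
    (h : HasSum (fun p : Nat.Primes ↦
      log ((p : ℕ) : ℝ) ^ 2 * koebeResidual (1 / ((p : ℕ) : ℝ))) a) :
    |a - koebeResidualSumApprox| ≤ 4 / 10 ^ 22 := by
  have h1 := hasSum_ite_prime (f := fun n ↦ log n ^ 2 * koebeResidual (1 / (n : ℝ))) h
  have h2 := h1.summable.sum_add_tsum_nat_add 64
  rw [h1.tsum_eq] at h2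
  have hs : Summable fun n : ℕ ↦ 17 * (1 / ((n + 64 : ℕ) : ℝ) ^ (12 + 1)) :=
    (((Real.summable_one_div_nat_pow (p := 13)).mpr (by norm_num)).comp_injective
      (add_left_injective 64)).mul_left 17
  have h3 : |∑' n : ℕ, if (n + 64).Prime then
      log ((n + 64 : ℕ) : ℝ) ^ 2 * koebeResidual (1 / ((n + 64 : ℕ) : ℝ)) else 0| ≤
      17 * (1 / (12 : ℕ) * (1 / (((64 : ℕ) : ℝ) - 1) ^ 12)) := by
    rw [← Real.norm_eq_abs]
    refine (tsum_of_norm_bounded hs.hasSum fun n ↦ ?_).trans ?_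
    · rw [Real.norm_eq_abs]
      split_ifs with hn
      · have hx : (64 : ℝ) ≤ ((n + 64 : ℕ) : ℝ) := by
          push_cast
          linarith [(n.cast_nonneg : (0 : ℝ) ≤ n)]
        set x := ((n + 64 : ℕ) : ℝ)
        have hx0 : 0 < x := by linarith
        rw [abs_mul, abs_of_nonneg (sq_nonneg _)]
        calc _ ≤ x * (17 * (1 / x) ^ 14) := by
              refine mul_le_mul (log_sq_le_self (by linarith))
                (abs_koebeResidual_le (by positivity) ?_) (abs_nonneg _) hx0.le
              gcongr
          _ = _ := by
              field_simp
      · rw [abs_zero]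
        positivity
    · rw [tsum_mul_left]
      gcongr
      exact tsum_one_div_pow_le (by norm_num) (by norm_num)
  have h4 : |(∑ n ∈ Finset.range 64, if n.Prime then
      log (n : ℝ) ^ 2 * koebeResidual (1 / (n : ℝ)) else 0) - koebeResidualSumApprox| ≤
      1 / 10 ^ 25 := by
    have hT : ∑ n ∈ Finset.range 64, (if n.Prime then
        9 / 10 ^ 28 * |koebeResidual (1 / (n : ℚ))| else 0) ≤ 1 / 10 ^ 25 := by
      decide +kernel
    have hc (n : ℕ) : koebeResidual (1 / (n : ℝ)) = ((koebeResidual (1 / (n : ℚ)) : ℚ) : ℝ) := by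
      simp only [koebeResidual, koebe]
      push_cast
      rfl
    replace hT := (Rat.cast_le (K := ℝ)).mpr hT
    rw [koebeResidualSumApprox]
    push_cast [apply_ite (Rat.cast : ℚ → ℝ)] at hT ⊢
    rw [← Finset.sum_sub_distrib]
    refine ((Finset.abs_sum_le_sum_abs _ _).trans (Finset.sum_le_sum fun n hn ↦ ?_)).trans hT
    split_ifs with hp
    · rw [hc, ← sub_mul, abs_mul]
      exact mul_le_mul_of_nonneg_right
        (abs_log_pow_sub_logTable_pow_le (Finset.mem_range.mp hn) le_rfl) (abs_nonneg _)
    · simp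
  replace h3 := h3.trans (by norm_num : _ ≤ (39 / 10 ^ 23 : ℝ))
  rw [abs_le] at h3 h4 ⊢
  constructor <;> linarith [h3.1, h3.2, h4.1, h4.2]

theorem primeLogSqSum_bounds :
    1.333215125623523151484 < 2 * (∑' p : Nat.Primes, log ((p : ℕ) : ℝ) ^ 2 / ((p : ℕ) : ℝ) ^ 2) -
      (∑' p : Nat.Primes, log ((p : ℕ) : ℝ) ^ 2 / ((p : ℕ) : ℝ) ^ 3) ∧
    2 * (∑' p : Nat.Primes, log ((p : ℕ) : ℝ) ^ 2 / ((p : ℕ) : ℝ) ^ 2) -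
      (∑' p : Nat.Primes, log ((p : ℕ) : ℝ) ^ 2 / ((p : ℕ) : ℝ) ^ 3) < 1.333215125623523151488 := by
  have hR := abs_sum_koebeResidual_sub_le hasSum_koebeResidual
  have h (r : ℕ) (hr : r ∈ ({0, 1, 2, 4, 7, 8, 10} : Finset ℕ)) :
      |∑' p : Nat.Primes, primeTerm (r + 2) p - primeTermSumApprox r| ≤ 1 / 10 ^ 24 := by
    rw [(hasSum_primeTerm (by omega)).tsum_eq]
    exact abs_logZeta_sub_primeTermSumApprox_le hr
  have h2 := h 0 (by decide)
  have h3 := h 1 (by decide)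
  have h4 := h 2 (by decide)
  have h6 := h 4 (by decide)
  have h9 := h 7 (by decide)
  have h10 := h 8 (by decide)
  have h12 := h 10 (by decide)
  have hT : |koebeResidualSumApprox + (2 * primeTermSumApprox 0 - primeTermSumApprox 1 -
      4 * primeTermSumApprox 2 - 4 * primeTermSumApprox 4 + 3 * primeTermSumApprox 7 -
      10 * primeTermSumApprox 8 + 12 * primeTermSumApprox 10) - 1.333215125623523151486| ≤
      1 / 10 ^ 21 := by
    decide +kernel
  replace hT := (Rat.cast_le (K := ℝ)).mpr hT
  rw [Rat.cast_abs] at hT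
  push_cast at hT
  norm_num only [] at h2 h3 h4 h6 h9 h10 h12
  rw [abs_le] at *
  constructor <;> linarith [hR.1, hR.2, h2.1, h2.2, h3.1, h3.2, h4.1, h4.2, h6.1, h6.2, h9.1, h9.2,
    h10.1, h10.2, h12.1, h12.2, hT.1, hT.2]

theorem abs_eulerMascheroniConstant_sub_decimal_le :
    |eulerMascheroniConstant - 0.5772156649015328606065121| ≤ 1 / 10 ^ 24 := by
  have h1 := abs_eulerMascheroniConstant_sub_le (k := 10) (by norm_num) (N := 32) (by norm_num)
  have h2 := abs_emPrimitive_sub_le 0 (0, 1, 0)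
  have hT : |∑ n ∈ Finset.range 32, 1 / (n : ℚ) - emPrimitiveApprox 0 (0, 1, 0) -
      0.5772156649015328606065121| + emPrimitiveError 0 (0, 1, 0) +
      emConstRat 0 (0, 1, 0) * (1 / 31 ^ 19) ≤ 1 / 10 ^ 24 := by
    decide +kernel
  replace hT := (Rat.cast_le (K := ℝ)).mpr hT
  rw [show 2 * 10 = 20 from rfl, emConst_eq, show ((32 : ℕ) : ℝ) - 1 = 31 by norm_num] at h1
  rw [Rat.cast_add, Rat.cast_add, Rat.cast_abs] at hT
  push_cast at h1 h2 hT
  refine le_trans ?_ hT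
  rw [abs_le] at h1 h2
  have h3 := le_abs_self ((∑ n ∈ Finset.range 32, 1 / (n : ℝ)) - emPrimitiveApprox 0 (0, 1, 0) -
      0.5772156649015328606065121)
  have h4 := neg_le_abs ((∑ n ∈ Finset.range 32, 1 / (n : ℝ)) - emPrimitiveApprox 0 (0, 1, 0) -
      0.5772156649015328606065121)
  rw [abs_le]
  constructor <;> linarith [h1.1, h1.2, h2.1, h2.2]

theorem exp_eulerMascheroniConstant_bounds :
    1.7810724179901979852364 < exp eulerMascheroniConstant ∧
      exp eulerMascheroniConstant < 1.7810724179901979852366 := by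
  have h := abs_eulerMascheroniConstant_sub_decimal_le
  rw [abs_le] at h
  have hlo : (1.7810724179901979852364 : ℚ) <
      ∑ i ∈ Finset.range 25, (0.577215664901532860606511 : ℚ) ^ i / i.factorial := by
    decide +kernel
  have hhi : ∑ i ∈ Finset.range 25, (0.577215664901532860606514 : ℚ) ^ i / i.factorial +
      0.577215664901532860606514 ^ 25 * (25 + 1) / (Nat.factorial 25 * 25) <
      1.7810724179901979852366 := by
    decide +kernel
  replace hlo := (Rat.cast_lt (K := ℝ)).mpr hlo
  replace hhi := (Rat.cast_lt (K := ℝ)).mpr hhi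
  push_cast at hlo hhi
  constructor
  · refine (hlo.trans_le (sum_le_exp_of_nonneg (by norm_num) 25)).trans_le (exp_le_exp.mpr ?_)
    linarith [h.1]
  · refine lt_of_le_of_lt ?_ hhi
    refine (exp_le_exp.mpr ?_).trans (exp_bound' (x := 0.577215664901532860606514) (by norm_num)
      (by norm_num) (n := 25) (by norm_num))
    linarith [h.2]

/-- The constant `Ca = 1 + e^{2γ}·(2·∑_{p prime} (ln²p)/p² - ∑_{p prime} (ln²p)/p³)
= 5.2292502967625442529…`, where both prime sums converge. -/
theorem Ca_bounds :
    Summable (fun p : Nat.Primes => (log ((p : ℕ) : ℝ)) ^ 2 / ((p : ℕ) : ℝ) ^ 2) ∧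
    Summable (fun p : Nat.Primes => (log ((p : ℕ) : ℝ)) ^ 2 / ((p : ℕ) : ℝ) ^ 3) ∧
    5.2292502967625442529 <
      1 + exp (2 * eulerMascheroniConstant) *
        (2 * (∑' p : Nat.Primes, (log ((p : ℕ) : ℝ)) ^ 2 / ((p : ℕ) : ℝ) ^ 2) -
          ∑' p : Nat.Primes, (log ((p : ℕ) : ℝ)) ^ 2 / ((p : ℕ) : ℝ) ^ 3) ∧
    1 + exp (2 * eulerMascheroniConstant) *
        (2 * (∑' p : Nat.Primes, (log ((p : ℕ) : ℝ)) ^ 2 / ((p : ℕ) : ℝ) ^ 2) -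
          ∑' p : Nat.Primes, (log ((p : ℕ) : ℝ)) ^ 2 / ((p : ℕ) : ℝ) ^ 3) <
      5.2292502967625442530 := by
  refine ⟨summable_log_sq_div_prime_pow le_rfl, summable_log_sq_div_prime_pow (by norm_num), ?_⟩
  obtain ⟨h1, h2⟩ := primeLogSqSum_bounds
  obtain ⟨h3, h4⟩ := exp_eulerMascheroniConstant_bounds
  rw [two_mul, exp_add, ← sq]
  set S := 2 * (∑' p : Nat.Primes, log ((p : ℕ) : ℝ) ^ 2 / ((p : ℕ) : ℝ) ^ 2) -
    (∑' p : Nat.Primes, log ((p : ℕ) : ℝ) ^ 2 / ((p : ℕ) : ℝ) ^ 3)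
  set E := exp eulerMascheroniConstant
  constructor
  · calc (5.2292502967625442529 : ℝ)
        < 1 + 1.7810724179901979852364 ^ 2 * 1.333215125623523151484 := by norm_num
      _ < 1 + E ^ 2 * S := by gcongr
  · have hS : 0 < S := by linarith
    calc 1 + E ^ 2 * S
        < 1 + 1.7810724179901979852366 ^ 2 * 1.333215125623523151488 := by gcongr
      _ < 5.2292502967625442530 := by norm_num
end
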